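/- arXiv:1007.0681 — 5 statements merged into one kernel-verified Lean document; each statement's English description precedes it below -/
import Mathlib

section
/- Let 1 ≤ p < ∞, let r > 0, and let V : ℝ² → ℝ² be a Borel measurable vector field. Then ∫_{ℝ²} ( ∫_{∂B_r(z)} |⟨V(x), (x−z)/r⟩|^p dH¹(x) ) dz = c_p · r · ∫_{ℝ²} ‖V(x)‖^p dx, where c_p = ∫_0^{2π} |cos t|^p dt (both sides being possibly equal to +∞). -/
open MeasureTheory Metric Real RealInnerProductSpace

namespace FluxAux

/-- The arc-length style parametrization of the circle of radius `r`. -/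
noncomputable def cir (r t : ℝ) : EuclideanSpace ℝ (Fin 2) := !₂[r * Real.cos t, r * Real.sin t]

lemma dist_cir (r : ℝ) (hr : 0 < r) (s t : ℝ) :
    dist (cir r s) (cir r t) = 2 * r * |Real.sin ((s - t) / 2)| := by
  have h2 : 2 * r * |Real.sin ((s - t) / 2)| = √((2 * r * Real.sin ((s - t) / 2)) ^ 2) := by
    rw [Real.sqrt_sq_eq_abs, abs_mul, abs_of_pos (by positivity : 0 < 2 * r)]
  rw [h2, EuclideanSpace.dist_eq]
  congr 1
  simp only [Fin.sum_univ_two, cir, Real.dist_eq, sq_abs]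
  have h3 : Real.cos (s - t) = 1 - 2 * Real.sin ((s - t) / 2) ^ 2 := by
    have := Real.cos_two_mul ((s - t) / 2)
    have h4 := Real.sin_sq_add_cos_sq ((s - t) / 2)
    rw [show 2 * ((s - t) / 2) = s - t by ring] at this
    linarith
  rw [Real.cos_sub] at h3
  have h5 := Real.sin_sq_add_cos_sq s
  have h6 := Real.sin_sq_add_cos_sq t
  simp
  linear_combination r ^ 2 * h5 + r ^ 2 * h6 - 2 * r ^ 2 * h3

lemma cir_lip (r : ℝ) (hr : 0 < r) : LipschitzWith (Real.toNNReal r) (cir r) := by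
  refine LipschitzWith.of_dist_le_mul fun s t => ?_
  rw [dist_cir r hr, Real.coe_toNNReal r hr.le, Real.dist_eq]
  have h := Real.abs_sin_le_abs (x := (s - t) / 2)
  rw [abs_div, abs_of_pos (by norm_num : (0:ℝ) < 2)] at h
  nlinarith

lemma cir_injOn (r : ℝ) (hr : 0 < r) : Set.InjOn (cir r) (Set.Ioc (-π) π) := by
  intro s hs t ht h
  have h1 := dist_cir r hr s t
  rw [h, dist_self] at h1
  have h2 : Real.sin ((s - t) / 2) = 0 := by
    have : |Real.sin ((s - t) / 2)| = 0 := by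
      rcases mul_eq_zero.1 h1.symm with h | h
      · linarith
      · exact h
    exact abs_eq_zero.1 this
  have h3 := (Real.sin_eq_zero_iff_of_lt_of_lt (x := (s - t) / 2)
    (by linarith [hs.1, ht.2]) (by linarith [hs.2, ht.1])).1 h2
  linarith

lemma upper (r : ℝ) (hr : 0 < r) (A : Set ℝ) :
    μH[1] (cir r '' A) ≤ ENNReal.ofReal r * volume A := by
  have := (cir_lip r hr).hausdorffMeasure_image_le (d := 1) zero_le_one A
  rw [hausdorffMeasure_real, ENNReal.rpow_one] at this
  exact this

lemma lower_small (r : ℝ) (hr : 0 < r) (d : ℝ) (hd : 0 < d) (hd1 : d < 1) (A : Set ℝ)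
    (hA : ∀ s ∈ A, ∀ t ∈ A, |s - t| ≤ d) :
    ENNReal.ofReal (r * (1 - d)) * volume A ≤ μH[1] (cir r '' A) := by
  have hk : 0 < r * (1 - d) := mul_pos hr (by linarith)
  have hanti : AntilipschitzWith (Real.toNNReal (r * (1 - d))⁻¹) (fun x : A => cir r x) := by
    refine AntilipschitzWith.of_le_mul_dist fun s t => ?_
    rw [dist_cir r hr, Real.coe_toNNReal _ (by positivity), Subtype.dist_eq, Real.dist_eq,
      inv_mul_eq_div, le_div_iff₀ hk]
    have h := hA s s.2 t t.2
    set u := (s : ℝ) - t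
    have h0 := abs_nonneg u
    have h1 := Real.sin_ge_sub_cube (x := |u| / 2) (by positivity)
    have h2 : Real.sin (|u| / 2) ≤ |Real.sin (u / 2)| := by
      rcases abs_cases u with ⟨h, _⟩ | ⟨h, _⟩ <;> rw [h]
      · exact le_abs_self _
      · rw [neg_div, Real.sin_neg]; exact neg_le_abs _
    have h3 : (|u| / 2) ^ 3 / 6 ≤ |u| * d / 2 := by
      have : |u| ^ 2 ≤ d := by nlinarith
      nlinarith
    nlinarith
  have h1 := hanti.le_hausdorffMeasure_image (d := 1) zero_le_one Set.univ
  rw [← (isometry_subtype_coe (s := A)).hausdorffMeasure_image (Or.inl zero_le_one),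
    Set.image_univ, Subtype.range_coe, hausdorffMeasure_real, ENNReal.rpow_one] at h1
  have h2 : (fun x : A => cir r x) '' Set.univ = cir r '' A := by
    ext; simp
  rw [h2] at h1
  calc _ ≤ ENNReal.ofReal (r * (1 - d)) * (ENNReal.ofReal (r * (1 - d))⁻¹ * μH[1] (cir r '' A)) := by
        gcongr; exact h1
    _ = _ := by
        rw [← mul_assoc, ← ENNReal.ofReal_mul hk.le, mul_inv_cancel₀ hk.ne', ENNReal.ofReal_one,
          one_mul]

lemma lower (r : ℝ) (hr : 0 < r) (d : ℝ) (hd : 0 < d) (hd1 : d < 1) (A : Set ℝ)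
    (hA : MeasurableSet A) (hs : A ⊆ Set.Ioc (-π) π) :
    ENNReal.ofReal (r * (1 - d)) * volume A ≤ μH[1] (cir r '' A) := by
  let P : ℤ → Set ℝ := fun n => A ∩ Set.Ioc (n • d) ((n + 1) • d)
  have hP : ∀ n, MeasurableSet (P n) := fun n => hA.inter measurableSet_Ioc
  have hU : A = ⋃ n, P n := by
    rw [← Set.inter_iUnion, iUnion_Ioc_zsmul hd, Set.inter_univ]
  have hD : Pairwise (Function.onFun Disjoint P) := fun i j hij =>
    (Set.pairwise_disjoint_Ioc_zsmul d hij).mono Set.inter_subset_right Set.inter_subset_right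
  have hPs : ∀ n, P n ⊆ Set.Ioc (-π) π := fun n => Set.inter_subset_left.trans hs
  have hinj := cir_injOn r hr
  have hv : volume A = ∑' n, volume (P n) := by
    conv_lhs => rw [hU]
    exact measure_iUnion hD hP
  have hm : μH[1] (cir r '' A) = ∑' n, μH[1] (cir r '' (P n)) := by
    conv_lhs => rw [hU, Set.image_iUnion]
    refine measure_iUnion (fun i j hij => ?_) fun n =>
      (hP n).image_of_continuousOn_injOn (cir_lip r hr).continuous.continuousOn
        (hinj.mono (hPs n))
    refine Set.disjoint_left.2 ?_
    rintro _ ⟨s, hsi, rfl⟩ ⟨t, htj, hts⟩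
    have hst := hinj (hPs j htj) (hPs i hsi) hts
    subst hst
    exact Set.disjoint_left.1 (hD hij) hsi htj
  rw [hv, hm, ← ENNReal.tsum_mul_left]
  refine ENNReal.tsum_le_tsum fun n => lower_small r hr d hd hd1 _ ?_
  rintro s ⟨_, hs1, hs2⟩ t ⟨_, ht1, ht2⟩
  rw [add_smul, one_smul] at hs2 ht2
  rw [abs_le]
  constructor <;> linarith

lemma meas_eq (r : ℝ) (hr : 0 < r) (A : Set ℝ)
    (hA : MeasurableSet A) (hs : A ⊆ Set.Ioc (-π) π) :
    μH[1] (cir r '' A) = ENNReal.ofReal r * volume A := by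
  refine le_antisymm (upper r hr A) ?_
  have hfin : volume A ≠ ⊤ := (lt_of_le_of_lt (measure_mono hs) (by simp)).ne
  have hfin2 : μH[1] (cir r '' A) ≠ ⊤ :=
    (lt_of_le_of_lt (upper r hr A) (ENNReal.mul_lt_top (by simp) hfin.lt_top)).ne
  have key : ∀ d ∈ Set.Ioo (0:ℝ) 1,
      r * (1 - d) * (volume A).toReal ≤ (μH[1] (cir r '' A)).toReal := by
    intro d hd
    have h := ENNReal.toReal_mono hfin2 (lower r hr d hd.1 hd.2 A hA hs)
    rwa [ENNReal.toReal_mul, ENNReal.toReal_ofReal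
      (mul_nonneg hr.le (by linarith [hd.2]))] at h
  have hlim : Filter.Tendsto (fun d : ℝ => r * (1 - d) * (volume A).toReal)
      (nhdsWithin 0 (Set.Ioi 0)) (nhds (r * (1 - 0) * (volume A).toReal)) :=
    (Continuous.tendsto (by fun_prop) 0).mono_left nhdsWithin_le_nhds
  have hle := le_of_tendsto hlim (Filter.mem_of_superset (Ioo_mem_nhdsGT one_pos) key)
  rw [← ENNReal.toReal_le_toReal (ENNReal.mul_ne_top (by simp) hfin) hfin2, ENNReal.toReal_mul,
    ENNReal.toReal_ofReal hr.le]
  simpa using hle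

lemma polar (v : EuclideanSpace ℝ (Fin 2)) :
    ∃ a ∈ Set.Ioc (-π) π, v 0 = ‖v‖ * Real.cos a ∧ v 1 = ‖v‖ * Real.sin a := by
  have hn : ‖v‖ = ‖(⟨v 0, v 1⟩ : ℂ)‖ := by
    rw [EuclideanSpace.norm_eq, Complex.norm_eq_sqrt_sq_add_sq]
    simp [Fin.sum_univ_two]
  refine ⟨Complex.arg ⟨v 0, v 1⟩, Complex.arg_mem_Ioc _, ?_, ?_⟩
  · rw [hn, Complex.norm_mul_cos_arg]
  · rw [hn, Complex.norm_mul_sin_arg]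

lemma cir_norm (r : ℝ) (hr : 0 < r) (t : ℝ) : ‖cir r t‖ = r := by
  rw [EuclideanSpace.norm_eq, Real.sqrt_eq_iff_mul_self_eq_of_pos hr]
  simp only [Fin.sum_univ_two, cir, Real.norm_eq_abs, sq_abs]
  have h5 := Real.sin_sq_add_cos_sq t
  simp
  linear_combination -r ^ 2 * h5

lemma restrict_eq (r : ℝ) (hr : 0 < r) :
    (μH[1] : Measure (EuclideanSpace ℝ (Fin 2))).restrict (sphere 0 r) =
      ENNReal.ofReal r • (volume.restrict (Set.Ioc (-π) π)).map (cir r) := by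
  have hm : Measurable (cir r) := (cir_lip r hr).continuous.measurable
  ext B hB
  rw [Measure.restrict_apply hB, Measure.smul_apply, Measure.map_apply hm hB,
    Measure.restrict_apply (hm hB), smul_eq_mul,
    ← meas_eq r hr _ ((hm hB).inter measurableSet_Ioc) Set.inter_subset_right]
  congr 1
  ext x
  constructor
  · rintro ⟨hxB, hx⟩
    obtain ⟨a, ha, h0, h1⟩ := polar x
    rw [mem_sphere_zero_iff_norm] at hx
    rw [hx] at h0 h1
    have : cir r a = x := by
      ext i
      fin_cases i
      · simp [cir, h0]
      · simp [cir, h1]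
    exact ⟨a, ⟨by simpa [this] using hxB, ha⟩, this⟩
  · rintro ⟨a, ⟨haB, _⟩, rfl⟩
    exact ⟨haB, by simp [cir_norm r hr]⟩

lemma inner_int (p r : ℝ) (hp : 1 ≤ p) (hr : 0 < r) (v : EuclideanSpace ℝ (Fin 2)) :
    ∫⁻ x in sphere 0 r, ENNReal.ofReal (|⟪v, r⁻¹ • x⟫| ^ p) ∂μH[1]
      = ENNReal.ofReal ((∫ t in (0:ℝ)..(2 * π), |Real.cos t| ^ p) * r)
          * ENNReal.ofReal (‖v‖ ^ p) := by
  have hm : Measurable (cir r) := (cir_lip r hr).continuous.measurable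
  have hp0 : 0 ≤ p := by linarith
  rw [restrict_eq r hr, lintegral_smul_measure, lintegral_map (by fun_prop) hm]
  obtain ⟨a, -, h0, h1⟩ := polar v
  have hc : ∀ t, |⟪v, r⁻¹ • cir r t⟫| ^ p = ‖v‖ ^ p * |Real.cos (t - a)| ^ p := by
    intro t
    have : ⟪v, r⁻¹ • cir r t⟫ = ‖v‖ * Real.cos (t - a) := by
      rw [inner_smul_right, PiLp.inner_apply, Fin.sum_univ_two, h0, h1, Real.cos_sub]
      simp [cir]
      field_simp
    rw [this, abs_mul, abs_norm, Real.mul_rpow (norm_nonneg _) (abs_nonneg _)]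
  have hcont : Continuous fun t => |Real.cos t| ^ p :=
    (continuous_abs.comp Real.continuous_cos).rpow_const fun _ => Or.inr hp0
  simp_rw [hc]
  have hcont2 : Continuous fun t => |Real.cos (t - a)| ^ p := by
    exact hcont.comp (continuous_id.sub continuous_const)
  have hper : Function.Periodic (fun t => |Real.cos t| ^ p) (2 * π) := fun t => by
    simp
  have hI : ∫ t in Set.Ioc (-π) π, |Real.cos (t - a)| ^ p
      = ∫ t in (0:ℝ)..(2 * π), |Real.cos t| ^ p := by
    rw [← intervalIntegral.integral_of_le (by linarith [Real.pi_pos]),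
      intervalIntegral.integral_comp_sub_right (fun t => |Real.cos t| ^ p) a]
    have := hper.intervalIntegral_add_eq (-π - a) 0
    rw [zero_add] at this
    rw [← this]
    congr 1
    ring
  have hint : IntegrableOn (fun t => ‖v‖ ^ p * |Real.cos (t - a)| ^ p) (Set.Ioc (-π) π) :=
    (continuous_const.mul hcont2).integrableOn_Ioc
  rw [← ofReal_integral_eq_lintegral_ofReal hint
    (Filter.Eventually.of_forall fun t => by simp only [Pi.zero_apply]; positivity),
    integral_const_mul, hI, ENNReal.ofReal_mul (by positivity), ENNReal.ofReal_mul' hr.le,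
    smul_eq_mul]
  ring

end FluxAux


/-- For `1 ≤ p < ∞`, `r > 0` and a Borel measurable vector field `V : ℝ² → ℝ²`:
`∫_{ℝ²} ( ∫_{∂B_r(z)} |⟨V(x), (x−z)/r⟩|^p dH¹(x) ) dz = c_p · r · ∫_{ℝ²} ‖V(x)‖^p dx`,
where `c_p = ∫_0^{2π} |cos t|^p dt` (both sides possibly `+∞`). -/
theorem lintegral_flux_density (p r : ℝ) (hp : 1 ≤ p) (hr : 0 < r)
    (V : EuclideanSpace ℝ (Fin 2) → EuclideanSpace ℝ (Fin 2)) (hV : Measurable V) :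
    ∫⁻ z, (∫⁻ x in sphere z r, ENNReal.ofReal (|⟪V x, r⁻¹ • (x - z)⟫| ^ p) ∂μH[1]) ∂volume
      = ENNReal.ofReal ((∫ t in (0:ℝ)..(2 * π), |Real.cos t| ^ p) * r)
          * ∫⁻ x, ENNReal.ofReal (‖V x‖ ^ p) ∂volume := by
  have hadd : Measurable fun q : EuclideanSpace ℝ (Fin 2) × EuclideanSpace ℝ (Fin 2) =>
      ENNReal.ofReal (|⟪V (q.2 + q.1), r⁻¹ • q.2⟫| ^ p) := by fun_prop
  have hadd2 : Measurable fun q : EuclideanSpace ℝ (Fin 2) × EuclideanSpace ℝ (Fin 2) =>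
      ENNReal.ofReal (|⟪V q.1, r⁻¹ • q.2⟫| ^ p) := by fun_prop
  have hsf : SFinite ((μH[1] : Measure (EuclideanSpace ℝ (Fin 2))).restrict (sphere 0 r)) := by
    rw [FluxAux.restrict_eq r hr]; infer_instance
  have h1 : ∀ z, ∫⁻ x in sphere z r, ENNReal.ofReal (|⟪V x, r⁻¹ • (x - z)⟫| ^ p) ∂μH[1]
      = ∫⁻ x in sphere 0 r, ENNReal.ofReal (|⟪V (x + z), r⁻¹ • x⟫| ^ p) ∂μH[1] := by
    intro z
    have h := ((IsometryEquiv.addRight z).measurePreserving_hausdorffMeasure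
      1).setLIntegral_comp_preimage (s := sphere z r) isClosed_sphere.measurableSet
      (f := fun x => ENNReal.ofReal (|⟪V x, r⁻¹ • (x - z)⟫| ^ p)) (by fun_prop)
    rw [← h]
    have hs : (IsometryEquiv.addRight z) ⁻¹' sphere z r = sphere 0 r := by
      ext x; simp
    rw [hs]
    simp
  simp_rw [h1]
  rw [lintegral_lintegral_swap hadd.aemeasurable]
  have h2 : ∀ x : EuclideanSpace ℝ (Fin 2),
      ∫⁻ z, ENNReal.ofReal (|⟪V (x + z), r⁻¹ • x⟫| ^ p)
      = ∫⁻ z, ENNReal.ofReal (|⟪V z, r⁻¹ • x⟫| ^ p) := fun x =>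
    lintegral_add_left_eq_self (fun z => ENNReal.ofReal (|⟪V z, r⁻¹ • x⟫| ^ p)) x
  simp_rw [h2]
  rw [← lintegral_lintegral_swap hadd2.aemeasurable]
  simp_rw [FluxAux.inner_int p r hp hr]
  rw [lintegral_const_mul _ (by fun_prop)]
end

section
/- For every 1 ≤ p < ∞ there is a constant C = C(p) > 0 with the following property. Let V : ℝ² → ℝ² be a Borel measurable vector field vanishing outside the open unit ball B² and with ∫_{ℝ²} ‖V‖^p dx < ∞, and let 0 < r ≤ 1. Then there exist N ∈ ℕ, points x₁,…,x_N ∈ ℝ², and a subset E ⊆ [3r/4, r]^N of positive N-dimensional Lebesgue measure, such that for every (r₁,…,r_N) ∈ E: (i) the balls B_{r_i}(x_i), i = 1,…,N, cover B²; (ii) the balls B_{(3/8)r_i}(x_i) are pairwise disjoint; (iii) ∑_{i=1}^N ∫_{∂B_{r_i}(x_i)} |⟨V(y), (y−x_i)/r_i⟩|^p dH¹(y) ≤ C r^{−1} ∫_{ℝ²} ‖V‖^p dx. -/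
open MeasureTheory Metric Real RealInnerProductSpace

open scoped ENNReal NNReal

/-- Polar parametrization of the circle of radius `s` about `x`. -/
noncomputable def circPar (x : EuclideanSpace ℝ (Fin 2)) (s θ : ℝ) : EuclideanSpace ℝ (Fin 2) :=
  x + !₂[s * Real.cos θ, s * Real.sin θ]

/-- Integral over the circle in polar coordinates. -/
noncomputable def circInt (f : EuclideanSpace ℝ (Fin 2) → ℝ≥0∞)
    (x : EuclideanSpace ℝ (Fin 2)) (s : ℝ) : ℝ≥0∞ :=
  ENNReal.ofReal s * ∫⁻ θ in Set.Ioc (-π) π, f (circPar x s θ)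

lemma circPar_continuous (x : EuclideanSpace ℝ (Fin 2)) :
    Continuous (fun q : ℝ × ℝ => circPar x q.1 q.2) := by
  unfold circPar
  refine continuous_const.add ?_
  refine (PiLp.continuous_toLp 2 _).comp ?_
  refine continuous_pi fun i => ?_
  fin_cases i <;> simp <;> fun_prop

lemma circPar_measurable (x : EuclideanSpace ℝ (Fin 2)) (s : ℝ) : Measurable (circPar x s) :=
  ((circPar_continuous x).comp (by fun_prop : Continuous fun θ : ℝ => (s, θ))).measurable

lemma circInt_measurable {f : EuclideanSpace ℝ (Fin 2) → ℝ≥0∞} (hf : Measurable f)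
    (x : EuclideanSpace ℝ (Fin 2)) : Measurable (circInt f x) := by
  unfold circInt
  refine ENNReal.measurable_ofReal.mul ?_
  exact Measurable.lintegral_prod_right' (f := fun q : ℝ × ℝ => f (circPar x q.1 q.2))
    (hf.comp (circPar_continuous x).measurable)

lemma circPar_dist (x : EuclideanSpace ℝ (Fin 2)) {s : ℝ} (hs : 0 ≤ s) (θ : ℝ) :
    dist (circPar x s θ) x = s := by
  rw [dist_eq_norm, circPar, add_sub_cancel_left, EuclideanSpace.norm_eq]
  simp only [Fin.sum_univ_two, Real.norm_eq_abs, sq_abs]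
  rw [Real.sqrt_eq_iff_mul_self_eq (by positivity) hs]
  simp
  nlinarith [Real.sin_sq_add_cos_sq θ]

lemma circPar_lipschitz (x : EuclideanSpace ℝ (Fin 2)) (s : ℝ≥0) :
    LipschitzWith s (circPar x s) := by
  refine LipschitzWith.of_dist_le_mul fun a b => ?_
  simp only [circPar, dist_add_left]
  rw [EuclideanSpace.dist_eq, Real.sqrt_le_left (by positivity)]
  simp only [Fin.sum_univ_two, Real.dist_eq, sq_abs, mul_pow]
  simp
  have h := Real.one_sub_sq_div_two_le_cos (x := a - b)
  rw [Real.cos_sub] at h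
  have e : (s * Real.cos a - s * Real.cos b) ^ 2 + (s * Real.sin a - s * Real.sin b) ^ 2
      = (s:ℝ) ^ 2 * (2 - 2 * (Real.cos a * Real.cos b + Real.sin a * Real.sin b)) := by
    linear_combination (s:ℝ)^2 * (Real.sin_sq_add_cos_sq a + Real.sin_sq_add_cos_sq b)
  rw [e]
  gcongr
  linarith

lemma circPar_surj (x : EuclideanSpace ℝ (Fin 2)) {s : ℝ}
    {y : EuclideanSpace ℝ (Fin 2)} (hy : y ∈ sphere x s) :
    ∃ θ ∈ Set.Ioc (-π) π, circPar x s θ = y := by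
  set z : ℂ := ⟨y 0 - x 0, y 1 - x 1⟩ with hz
  have hn : ‖z‖ = s := by
    rw [mem_sphere, EuclideanSpace.dist_eq] at hy
    rw [← hy, Complex.norm_eq_sqrt_sq_add_sq]
    simp [hz, Fin.sum_univ_two, Real.dist_eq, sq_abs]
  refine ⟨z.arg, Complex.arg_mem_Ioc z, ?_⟩
  have h1 := Complex.norm_mul_cos_arg z
  have h2 := Complex.norm_mul_sin_arg z
  rw [hn] at h1 h2
  ext i
  fin_cases i
  · simp only [circPar, h1, h2]
    simp [hz]
  · simp only [circPar, h1, h2]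
    simp [hz]

lemma sphere_measure_le (x : EuclideanSpace ℝ (Fin 2)) {s : ℝ} (hs : 0 ≤ s) :
    (μH[1] : Measure (EuclideanSpace ℝ (Fin 2))).restrict (sphere x s) ≤
      ENNReal.ofReal s • Measure.map (circPar x s) (volume.restrict (Set.Ioc (-π) π)) := by
  refine Measure.le_iff.2 fun B hB => ?_
  lift s to ℝ≥0 using hs
  rw [Measure.restrict_apply hB, Measure.smul_apply,
    Measure.map_apply (circPar_measurable x s) hB,
    Measure.restrict_apply (circPar_measurable x s hB)]
  have hsub : B ∩ sphere x s ⊆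
      circPar x s '' (circPar x s ⁻¹' B ∩ Set.Ioc (-π) π) := by
    rintro y ⟨hyB, hy⟩
    obtain ⟨θ, hθ, rfl⟩ := circPar_surj x hy
    exact ⟨θ, ⟨hyB, hθ⟩, rfl⟩
  refine (measure_mono hsub).trans ?_
  refine ((circPar_lipschitz x s).hausdorffMeasure_image_le zero_le_one _).trans ?_
  simp [hausdorffMeasure_real]

lemma sphere_lintegral_le {f : EuclideanSpace ℝ (Fin 2) → ℝ≥0∞} (hf : Measurable f)
    (x : EuclideanSpace ℝ (Fin 2)) {s : ℝ} (hs : 0 ≤ s) :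
    ∫⁻ y in sphere x s, f y ∂μH[1] ≤ circInt f x s := by
  refine (lintegral_mono' (sphere_measure_le x hs) le_rfl).trans ?_
  rw [lintegral_smul_measure, lintegral_map hf (circPar_measurable x s)]
  rfl

lemma polar_total {f : EuclideanSpace ℝ (Fin 2) → ℝ≥0∞} (hf : Measurable f)
    (x : EuclideanSpace ℝ (Fin 2)) :
    ∫⁻ s in Set.Ioi (0:ℝ), circInt f x s = ∫⁻ y, f y := by
  have mp : MeasurePreserving (fun q : ℝ × ℝ => (!₂[q.1, q.2] : EuclideanSpace ℝ (Fin 2)))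
      volume volume := by
    have := (PiLp.volume_preserving_toLp (Fin 2)).comp
      ((volume_preserving_finTwoArrow ℝ).symm MeasurableEquiv.finTwoArrow)
    have e : (fun q : ℝ × ℝ => (!₂[q.1, q.2] : EuclideanSpace ℝ (Fin 2))) =
        WithLp.toLp 2 ∘ MeasurableEquiv.finTwoArrow.symm := by
      funext q
      ext i
      fin_cases i <;> rfl
    rw [e]
    exact this
  have e1 : ∫⁻ y, f y = ∫⁻ q : ℝ × ℝ, f (x + !₂[q.1, q.2]) := by
    rw [← lintegral_add_left_eq_self f x]
    exact (mp.lintegral_comp (hf.comp (measurable_const_add x))).symm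
  have hm : Measurable fun q : ℝ × ℝ => ENNReal.ofReal q.1 • f (circPar x q.1 q.2) :=
    (ENNReal.measurable_ofReal.comp measurable_fst).mul
      (hf.comp (circPar_continuous x).measurable)
  rw [e1, ← lintegral_comp_polarCoord_symm, polarCoord_target, Measure.volume_eq_prod,
    ← Measure.prod_restrict]
  have := lintegral_prod (μ := volume.restrict (Set.Ioi (0:ℝ)))
    (ν := volume.restrict (Set.Ioo (-π) π)) _ hm.aemeasurable
  simp only [polarCoord_symm_apply]
  refine Eq.trans ?_ this.symm
  refine lintegral_congr fun s => ?_
  simp only [smul_eq_mul]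
  rw [lintegral_const_mul (ENNReal.ofReal s) (f := fun θ => f (circPar x s θ))
    (hf.comp (circPar_measurable x s)), circInt,
    Measure.restrict_congr_set Ioo_ae_eq_Ioc]

lemma polar_local {f : EuclideanSpace ℝ (Fin 2) → ℝ≥0∞} (hf : Measurable f)
    (x : EuclideanSpace ℝ (Fin 2)) {a r : ℝ} (ha : 0 ≤ a) :
    ∫⁻ s in Set.Ioc a r, circInt f x s ≤ ∫⁻ y in closedBall x r, f y := by
  rw [← lintegral_indicator measurableSet_closedBall,
    ← polar_total (hf.indicator measurableSet_closedBall) x]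
  refine le_trans (le_of_eq ?_)
    (lintegral_mono_set (fun s hs => ha.trans_lt hs.1 : Set.Ioc a r ⊆ Set.Ioi 0))
  refine setLIntegral_congr_fun measurableSet_Ioc fun s hs => ?_
  simp only [circInt]
  congr 1
  refine lintegral_congr fun θ => ?_
  rw [Set.indicator_of_mem]
  rw [mem_closedBall, circPar_dist x (ha.trans hs.1.le)]
  exact hs.2

lemma exists_net {ε : ℝ} (hε : 0 < ε) :
    ∃ C : Set (EuclideanSpace ℝ (Fin 2)), C.Finite ∧
      (∀ a ∈ C, ∀ b ∈ C, a ≠ b → ε ≤ dist a b) ∧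
      ball 0 1 ⊆ ⋃ y ∈ C, closedBall y ε := by
  lift ε to ℝ≥0 using hε.le
  set A : Set (EuclideanSpace ℝ (Fin 2)) := ball 0 1
  have hε' : ε / 2 ≠ 0 := by
    have : ε ≠ 0 := by rintro rfl; simp at hε
    simp [this]
  have hfin : packingNumber ε A ≠ ⊤ := by
    obtain ⟨N, -, hN, hc⟩ := exists_finite_isCover_of_totallyBounded hε'
      ((isCompact_closedBall (0 : EuclideanSpace ℝ (Fin 2)) 1).totallyBounded.subset
        ball_subset_closedBall)
    have h := packingNumber_two_mul_le_externalCoveringNumber (ε / 2) A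
    rw [mul_div_cancel₀ _ (two_ne_zero)] at h
    exact ne_top_of_le_ne_top (by simpa using hN) (h.trans hc.externalCoveringNumber_le_encard)
  refine ⟨maximalSeparatedSet ε A, ?_, ?_, ?_⟩
  · rw [← Set.encard_ne_top_iff, encard_maximalSeparatedSet hfin]; exact hfin
  · intro a ha b hb hab
    have : (ε : ℝ≥0∞) < edist a b := isSeparated_maximalSeparatedSet ha hb hab
    rw [edist_nndist] at this
    exact_mod_cast this.le
  · exact isCover_iff_subset_iUnion_closedBall.1 (isCover_maximalSeparatedSet hfin)

lemma overlap {N : ℕ} {r : ℝ} (hr : 0 < r) (x : Fin N → EuclideanSpace ℝ (Fin 2))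
    (hx : ∀ i j, i ≠ j → 3 * r / 4 ≤ dist (x i) (x j)) (f : EuclideanSpace ℝ (Fin 2) → ℝ≥0∞)
    (hf : Measurable f) :
    ∑ i, ∫⁻ y in closedBall (x i) r, f y ≤ 25 * ∫⁻ y, f y := by
  simp_rw [← lintegral_indicator measurableSet_closedBall]
  rw [← lintegral_finsetSum _ (fun i _ => hf.indicator measurableSet_closedBall),
    ← lintegral_const_mul _ hf]
  refine lintegral_mono fun y => ?_
  classical
  simp only [Set.indicator_apply]
  rw [← Finset.sum_filter, Finset.sum_const, nsmul_eq_mul]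
  gcongr
  set S := Finset.univ.filter fun i => y ∈ closedBall (x i) r
  set g : Fin N → EuclideanSpace ℝ (Fin 2) := fun i => (4 / (3 * r)) • (x i - y)
  have hg : ∀ i j, i ≠ j → 1 ≤ ‖g i - g j‖ := by
    intro i j hij
    have h := hx i j hij
    rw [dist_eq_norm] at h
    simp only [g]
    rw [← smul_sub, sub_sub_sub_cancel_right, norm_smul, Real.norm_of_nonneg (by positivity),
      div_mul_eq_mul_div, le_div_iff₀ (by positivity)]
    linarith
  have hinj : Function.Injective g := by
    intro i j hij
    by_contra hne
    have := hg i j hne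
    rw [hij] at this
    norm_num at this
  have h := Besicovitch.card_le_of_separated (S.image g) (by
      intro c hc
      obtain ⟨i, hi, rfl⟩ := Finset.mem_image.1 hc
      have hi' : y ∈ closedBall (x i) r := by simpa [S] using hi
      rw [mem_closedBall, dist_comm, dist_eq_norm] at hi'
      simp only [g]
      rw [norm_smul, Real.norm_of_nonneg (by positivity),
        div_mul_eq_mul_div, div_le_iff₀ (by positivity)]
      linarith) (by
      intro c hc d hd hcd
      obtain ⟨i, hi, rfl⟩ := Finset.mem_image.1 hc
      obtain ⟨j, hj, rfl⟩ := Finset.mem_image.1 hd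
      exact hg i j (fun h => hcd (h ▸ rfl)))
  rw [Finset.card_image_of_injective _ hinj] at h
  simp at h
  exact_mod_cast h

/-- Refined covering: for `1 ≤ p < ∞` there is `C = C(p) > 0` such that for every
Borel measurable `V : ℝ² → ℝ²` vanishing outside the unit ball with `∫‖V‖^p < ∞` and
every `0 < r ≤ 1`, there are `N` centers and a positive-measure set
`E ⊆ [3r/4, r]^N` of radius-vectors such that for every `(r₁,…,r_N) ∈ E` the balls
`B_{r_i}(x_i)` cover the unit ball, the balls `B_{(3/8)r_i}(x_i)` are pairwise
disjoint, and the total `p`-flux energy through the circles `∂B_{r_i}(x_i)` is at most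
`C r⁻¹ ∫‖V‖^p`. -/
theorem good_covering_exists_refined (p : ℝ) (hp : 1 ≤ p) :
    ∃ C : ℝ, 0 < C ∧
      ∀ (V : EuclideanSpace ℝ (Fin 2) → EuclideanSpace ℝ (Fin 2)),
        Measurable V →
        (∀ x, x ∉ ball (0 : EuclideanSpace ℝ (Fin 2)) 1 → V x = 0) →
        (∫⁻ x, ENNReal.ofReal (‖V x‖ ^ p) ∂volume) < ⊤ →
        ∀ r : ℝ, 0 < r → r ≤ 1 →
        ∃ (N : ℕ) (x : Fin N → EuclideanSpace ℝ (Fin 2)) (E : Set (Fin N → ℝ)),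
          E ⊆ Set.univ.pi (fun _ => Set.Icc (3 * r / 4) r) ∧
          MeasurableSet E ∧ 0 < volume E ∧
          ∀ ρ ∈ E,
            (ball (0 : EuclideanSpace ℝ (Fin 2)) 1 ⊆ ⋃ i, ball (x i) (ρ i)) ∧
            (∀ i j : Fin N, i ≠ j →
              Disjoint (ball (x i) (3 / 8 * ρ i)) (ball (x j) (3 / 8 * ρ j))) ∧
            (∑ i : Fin N, ∫⁻ y in sphere (x i) (ρ i),
                ENNReal.ofReal (|⟪V y, (ρ i)⁻¹ • (y - x i)⟫| ^ p) ∂μH[1])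
              ≤ ENNReal.ofReal (C * r⁻¹) * ∫⁻ y, ENNReal.ofReal (‖V y‖ ^ p) ∂volume := by
  refine ⟨100, by norm_num, fun V hV _ _ r hr _ => ?_⟩
  set f : EuclideanSpace ℝ (Fin 2) → ℝ≥0∞ := fun y => ENNReal.ofReal (‖V y‖ ^ p) with hfdef
  have hf : Measurable f := (hV.norm.pow_const p).ennreal_ofReal
  obtain ⟨C, hCfin, hCsep, hCcov⟩ := exists_net (ε := 3 * r / 4) (by positivity)
  obtain ⟨N, x, hxinj, hxr⟩ := hCfin.fin_param
  have hxC : ∀ i, x i ∈ C := fun i => hxr ▸ Set.mem_range_self i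
  have hxs : ∀ i j, i ≠ j → 3 * r / 4 ≤ dist (x i) (x j) := fun i j hij =>
    hCsep _ (hxC i) _ (hxC j) (fun h => hij (hxinj h))
  set A : Fin N → ℝ≥0∞ := fun i => ⨍⁻ s in Set.Ioc (3 * r / 4) r, circInt f (x i) s ∂volume
  set F : Fin N → Set ℝ := fun i => {s ∈ Set.Ioc (3 * r / 4) r | circInt f (x i) s ≤ A i}
  have hvol : volume (Set.Ioc (3 * r / 4) r) = ENNReal.ofReal (r / 4) := by
    rw [Real.volume_Ioc]; congr 1; ring
  have hFpos : ∀ i, 0 < volume (F i) := fun i =>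
    measure_le_setLAverage_pos (by rw [hvol]; simpa using hr) (by rw [hvol]; simp)
      (circInt_measurable hf (x i)).aemeasurable
  refine ⟨N, x, Set.univ.pi F, ?_, ?_, ?_, ?_⟩
  · exact Set.pi_mono fun i _ s hs => Set.Ioc_subset_Icc_self hs.1
  · exact MeasurableSet.univ_pi fun i => measurableSet_Ioc.inter
      (measurableSet_le (circInt_measurable hf (x i)) measurable_const)
  · rw [volume_pi_pi]
    exact pos_iff_ne_zero.2 (Finset.prod_ne_zero_iff.2 fun i _ => (hFpos i).ne')
  intro ρ hρ
  have hρ' : ∀ i, ρ i ∈ F i := fun i => hρ i (Set.mem_univ i)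
  refine ⟨?_, ?_, ?_⟩
  · intro y hy
    obtain ⟨c, hc, hyc⟩ := Set.mem_iUnion₂.1 (hCcov hy)
    rw [← hxr] at hc
    obtain ⟨i, rfl⟩ := hc
    exact Set.mem_iUnion.2 ⟨i, (mem_closedBall.1 hyc).trans_lt (hρ' i).1.1⟩
  · intro i j hij
    refine ball_disjoint_ball ?_
    have h1 := (hρ' i).1.2
    have h2 := (hρ' j).1.2
    have := hxs i j hij
    linarith
  have hρ0 : ∀ i, 0 < ρ i := fun i => lt_trans (by positivity) (hρ' i).1.1
  calc _ ≤ ∑ i, A i := by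
        refine Finset.sum_le_sum fun i _ => ?_
        refine le_trans ?_ ((sphere_lintegral_le hf (x i) (hρ0 i).le).trans (hρ' i).2)
        refine setLIntegral_mono hf fun y hy => ?_
        refine ENNReal.ofReal_le_ofReal ?_
        refine Real.rpow_le_rpow (abs_nonneg _) ?_ (by linarith)
        refine (abs_real_inner_le_norm _ _).trans ?_
        rw [norm_smul, ← dist_eq_norm, mem_sphere.1 hy, Real.norm_of_nonneg
          (inv_nonneg.2 (hρ0 i).le), inv_mul_cancel₀ (hρ0 i).ne', mul_one]
    _ ≤ ∑ i, ENNReal.ofReal (4 * r⁻¹) * ∫⁻ y in closedBall (x i) r, f y := by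
        refine Finset.sum_le_sum fun i _ => ?_
        simp only [A]
        rw [setLAverage_eq, hvol, ENNReal.div_eq_inv_mul,
          ← ENNReal.ofReal_inv_of_pos (by positivity)]
        have : (r / 4)⁻¹ = 4 * r⁻¹ := by rw [inv_div]; rfl
        rw [this]
        gcongr
        exact polar_local hf (x i) (by positivity)
    _ ≤ ENNReal.ofReal (4 * r⁻¹) * (25 * ∫⁻ y, f y) := by
        rw [← Finset.mul_sum]
        gcongr
        exact overlap hr x hxs f hf
    _ = _ := by
        rw [← mul_assoc]
        congr 1
        rw [show (25 : ℝ≥0∞) = ENNReal.ofReal 25 by simp, ← ENNReal.ofReal_mul (by positivity)]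
        congr 1
        ring
end

section
/- For every 1 ≤ p < ∞ there is a constant C = C(p) > 0 such that the following holds. Let A : ℝ² → ℝ be continuously differentiable on the closed unit ball (i.e., A is C¹ on an open neighborhood of the closed unit ball) and harmonic on the open unit ball B², i.e., ∂²A/∂x₁² + ∂²A/∂x₂² = 0 on B². Then ∫_{B²} ‖∇A(x)‖^p dx ≤ C ∫_{S¹} |⟨∇A(y), (−y₂, y₁)⟩|^p dH¹(y); that is, the L^p norm of the gradient of the harmonic function on the disc is controlled by the L^p norm of the tangential derivative of its boundary values on the unit circle. -/
open MeasureTheory Metric Real RealInnerProductSpace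


lemma aux_ne {z : ℂ} (hz : z ∈ ball (0:ℂ) 1) (φ : ℝ) : circleMap 0 1 φ - z ≠ 0 := by
  intro h
  rw [sub_eq_zero] at h
  rw [← h] at hz
  simp at hz

lemma aux_pos {z : ℂ} (hz : z ∈ ball (0:ℂ) 1) (φ : ℝ) : 0 < ‖circleMap 0 1 φ - z‖ :=
  norm_pos_iff.2 (aux_ne hz φ)

lemma aux_schwarz (F : ℂ → ℂ) (hc : ContinuousOn F (closedBall 0 1))
    (hd : DifferentiableOn ℂ F (ball 0 1)) {z : ℂ} (hz : z ∈ ball (0:ℂ) 1) :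
    π * ‖F z‖ ≤ ∫ φ in (0:ℝ)..(2*π),
      |(circleMap 0 1 φ * F (circleMap 0 1 φ)).im| * ‖circleMap 0 1 φ - z‖⁻¹ := by
  have hdc : DiffContOnCl ℂ F (ball 0 1) := ⟨hd, by rwa [closure_ball _ one_ne_zero]⟩
  have h1 := hdc.circleIntegral_sub_inv_smul hz
  have hz1 : ‖z‖ < 1 := by simpa using hz
  have hne : ∀ w ∈ closedBall (0:ℂ) 1, 1 - (starRingEnd ℂ) z * w ≠ 0 := by
    intro w hw h
    have hw1 : ‖w‖ ≤ 1 := by simpa using hw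
    have : ‖(starRingEnd ℂ) z * w‖ = 1 := by rw [← sub_eq_zero.1 h]; simp
    rw [norm_mul, RCLike.norm_conj] at this
    nlinarith [norm_nonneg z, norm_nonneg w]
  have h2 : (∮ w in C(0, 1), w * F w / (1 - (starRingEnd ℂ) z * w)) = 0 := by
    apply Complex.circleIntegral_eq_zero_of_differentiable_on_off_countable zero_le_one
      Set.countable_empty
    · exact (continuousOn_id.mul hc).div (by fun_prop) hne
    · intro w hw
      have hw' : w ∈ ball (0:ℂ) 1 := hw.1
      have := hd.differentiableAt (isOpen_ball.mem_nhds hw')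
      exact (differentiableAt_id.mul this).div (by fun_prop) (hne w (ball_subset_closedBall hw'))
  set γ := circleMap 0 1 with hγ
  have hγc : Continuous γ := continuous_circleMap 0 1
  have hmem : ∀ φ, γ φ ∈ closedBall (0:ℂ) 1 := fun φ => circleMap_mem_closedBall _ zero_le_one φ
  have hFc : Continuous (fun φ => F (γ φ)) := hc.comp_continuous hγc hmem
  have hγn : ∀ φ, (starRingEnd ℂ) (γ φ) * γ φ = 1 := by
    intro φ
    rw [mul_comm, Complex.mul_conj, Complex.normSq_eq_norm_sq]; simp [hγ]
  have e1 : (∫ φ in (0:ℝ)..(2*π), γ φ * F (γ φ) * (γ φ - z)⁻¹) = 2 * π * F z := by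
    simp only [circleIntegral, deriv_circleMap, smul_eq_mul] at h1
    have : (∫ φ in (0:ℝ)..(2*π), Complex.I * (γ φ * F (γ φ) * (γ φ - z)⁻¹)) 
        = Complex.I * (2 * π * F z) := by
      rw [show Complex.I * (2 * π * F z) = 2 * π * Complex.I * F z by ring, ← h1]
      congr 1; ext φ; ring
    rw [intervalIntegral.integral_const_mul] at this
    exact mul_left_cancel₀ Complex.I_ne_zero this
  have e2 : (∫ φ in (0:ℝ)..(2*π), (starRingEnd ℂ) (γ φ * F (γ φ)) * (γ φ - z)⁻¹) = 0 := by
    simp only [circleIntegral, deriv_circleMap, smul_eq_mul] at h2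
    have h3 : (∫ φ in (0:ℝ)..(2*π), Complex.I * (γ φ * F (γ φ) * ((starRingEnd ℂ) (γ φ - z))⁻¹)) = 0 := by
      rw [← h2]
      congr 1; ext φ
      have : (starRingEnd ℂ) (γ φ - z) = (starRingEnd ℂ) (γ φ) * (1 - (starRingEnd ℂ) z * γ φ) := by
        rw [map_sub]; linear_combination ((starRingEnd ℂ) z) * hγn φ
      rw [this]
      have h4 : γ φ = ((starRingEnd ℂ) (γ φ))⁻¹ := eq_inv_of_mul_eq_one_right (hγn φ)
      rw [mul_inv, ← h4, div_eq_mul_inv]; ring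
    rw [intervalIntegral.integral_const_mul] at h3
    have h4 := (mul_eq_zero.1 h3).resolve_left Complex.I_ne_zero
    have h5 := congrArg (starRingEnd ℂ) h4
    rw [map_zero, intervalIntegral.integral_of_le (by positivity), ← integral_conj, ← intervalIntegral.integral_of_le (by positivity)] at h5
    rw [← h5]
    congr 1; ext φ
    simp
  have hcK : Continuous (fun φ => (γ φ - z)⁻¹) := (hγc.sub continuous_const).inv₀ (aux_ne hz)
  have e3 : (∫ φ in (0:ℝ)..(2*π), (((γ φ * F (γ φ)).im : ℝ) : ℂ) * (γ φ - z)⁻¹ * (2 * Complex.I)) = 2 * π * F z := by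
    rw [← e1, ← sub_zero (∫ φ in (0:ℝ)..(2*π), γ φ * F (γ φ) * (γ φ - z)⁻¹), ← e2,
      ← intervalIntegral.integral_sub]
    · congr 1; ext φ
      rw [← sub_mul, Complex.sub_conj]; push_cast; ring
    · exact ((hγc.mul hFc).mul hcK).intervalIntegrable _ _
    · exact ((Complex.continuous_conj.comp (hγc.mul hFc)).mul hcK).intervalIntegrable _ _
  have e4 := intervalIntegral.norm_integral_le_integral_norm (μ := volume) (a := 0) (b := 2*π)
    (f := fun φ => (((γ φ * F (γ φ)).im : ℝ) : ℂ) * (γ φ - z)⁻¹ * (2 * Complex.I)) (by positivity)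
  rw [e3] at e4
  have e5 : (∫ φ in (0:ℝ)..(2*π), ‖(((γ φ * F (γ φ)).im : ℝ) : ℂ) * (γ φ - z)⁻¹ * (2 * Complex.I)‖)
    = (∫ φ in (0:ℝ)..(2*π), |(γ φ * F (γ φ)).im| * ‖γ φ - z‖⁻¹) * 2 := by
    rw [← intervalIntegral.integral_mul_const]
    congr 1; ext φ
    rw [norm_mul, norm_mul, norm_mul, norm_inv, Complex.norm_I, Complex.norm_real, Real.norm_eq_abs]
    simp
  rw [e5] at e4
  have : ‖2 * (π:ℂ) * F z‖ = 2 * (π * ‖F z‖) := by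
    rw [norm_mul, norm_mul, Complex.norm_real, Real.norm_eq_abs, abs_of_pos pi_pos]; simp; ring
  linarith

lemma aux_le_two {z : ℂ} (hz : z ∈ ball (0:ℂ) 1) (φ : ℝ) : ‖circleMap 0 1 φ - z‖ ≤ 2 := by
  have h := norm_sub_le (circleMap 0 1 φ) z
  have hz : ‖z‖ < 1 := by simpa using hz
  simp at h
  linarith

lemma aux_chord (a b : ℝ) (h : |a - b| ≤ π) :
    2 / π * |a - b| ≤ ‖circleMap 0 1 a - circleMap 0 1 b‖ := by
  have e : ‖circleMap 0 1 a - circleMap 0 1 b‖ = ‖2 * Real.sin ((a - b)/2)‖ := by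
    rw [← Complex.norm_exp_I_mul_ofReal_sub_one (a - b)]
    have : circleMap 0 1 a - circleMap 0 1 b = 
      circleMap 0 1 b * (Complex.exp (Complex.I * ((a - b : ℝ) : ℂ)) - 1) := by
      simp only [circleMap, zero_add, Complex.ofReal_one, one_mul, mul_sub, mul_one,
        ← Complex.exp_add]
      congr 2
      push_cast; ring
    rw [this, norm_mul]; simp
  rw [e, norm_mul, Real.norm_eq_abs, Real.norm_eq_abs, abs_two]
  have h1 := Real.mul_abs_le_abs_sin (x := (a-b)/2) (by rw [abs_div, abs_two]; linarith)
  rw [abs_div, abs_two] at h1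
  calc 2 / π * |a - b| = 2 * (2 / π * (|a-b|/2)) := by ring
    _ ≤ _ := by linarith

lemma aux_circle_int (t : ℝ) (ht : t < 1) : ∃ M : ℝ, 0 ≤ M ∧ ∀ z ∈ ball (0:ℂ) 1,
    ∫ φ in (0:ℝ)..(2*π), ‖circleMap 0 1 φ - z‖ ^ (-t) ≤ M := by
  have hcont : ∀ z ∈ ball (0:ℂ) 1, Continuous fun φ => ‖circleMap 0 1 φ - z‖ ^ (-t) := by
    intro z hz
    exact ((continuous_circleMap 0 1).sub continuous_const).norm.rpow_const
      (fun φ => Or.inl (aux_pos hz φ).ne')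
  rcases le_or_gt t 0 with h | h
  · refine ⟨∫ φ in (0:ℝ)..(2*π), (2:ℝ) ^ (-t), ?_, ?_⟩
    · apply intervalIntegral.integral_nonneg (by positivity)
      intros; positivity
    · intro z hz
      apply intervalIntegral.integral_mono_on (by positivity) ((hcont z hz).intervalIntegrable _ _)
        (by simp)
      intro φ _
      exact rpow_le_rpow (norm_nonneg _) (aux_le_two hz φ) (by linarith)
  · have hint0 : IntervalIntegrable (fun u : ℝ => (|u| / π) ^ (-t)) volume 0 π := by
      have h1 := (intervalIntegral.intervalIntegrable_rpow' (a := 0) (b := π) (r := -t) (by linarith)).mul_const (π ^ (-t))⁻¹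
      refine h1.congr ?_
      intro u hu
      rw [Set.uIoc_of_le pi_pos.le] at hu
      simp only
      rw [abs_of_pos hu.1, div_rpow hu.1.le pi_pos.le, div_eq_mul_inv]
    have hint1 : IntervalIntegrable (fun u : ℝ => (|u| / π) ^ (-t)) volume (-π) 0 := by
      rw [IntervalIntegrable.iff_comp_neg]
      simpa using hint0.symm
    have hint := hint1.trans hint0
    refine ⟨∫ u in (-π)..π, (|u| / π) ^ (-t), ?_, ?_⟩
    · apply intervalIntegral.integral_nonneg (by linarith [pi_pos])
      intros; positivity
    · intro z hz
      set α := Complex.arg z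
      have hz1 : ‖z‖ < 1 := by simpa using hz
      have hw : ‖circleMap 0 1 α - z‖ = 1 - ‖z‖ := by
        have : circleMap 0 1 α - z = ((1 - ‖z‖ : ℝ) : ℂ) * circleMap 0 1 α := by
          have := Complex.norm_mul_exp_arg_mul_I z
          simp only [circleMap]
          push_cast
          linear_combination this
        rw [this, norm_mul, Complex.norm_real, Real.norm_eq_abs, abs_of_pos (by linarith)]; simp
      have hper : Function.Periodic (fun φ => ‖circleMap 0 1 φ - z‖ ^ (-t)) (2*π) := by
        intro φ
        simp only [periodic_circleMap 0 1 φ]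
      have e1 := hper.intervalIntegral_add_eq 0 (-π + α)
      rw [zero_add] at e1
      rw [e1, show -π + α + 2 * π = π + α by ring,
        ← intervalIntegral.integral_comp_add_right (fun φ => ‖circleMap 0 1 φ - z‖ ^ (-t)) α]
      apply intervalIntegral.integral_mono_ae_restrict (by linarith [pi_pos])
        (((hcont z hz).comp (continuous_add_const α)).intervalIntegrable _ _) hint
      have hae : ∀ᵐ u : ℝ ∂(volume.restrict (Set.Icc (-π) π)), u ≠ 0 :=
        ae_restrict_of_ae (Measure.ae_ne volume 0)
      filter_upwards [hae, ae_restrict_mem measurableSet_Icc] with u hu0 hu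
      have hu' : |u| ≤ π := abs_le.2 hu
      have h1 := aux_chord (u + α) α (by simpa using hu')
      rw [add_sub_cancel_right] at h1
      have h2 := norm_sub_le_norm_sub_add_norm_sub (circleMap 0 1 (u + α)) z (circleMap 0 1 α)
      have h3 : 1 - ‖z‖ ≤ ‖circleMap 0 1 (u + α) - z‖ := by
        have := norm_sub_norm_le (circleMap 0 1 (u + α)) z
        simpa using this
      rw [norm_sub_rev z, hw] at h2
      apply rpow_le_rpow_of_nonpos (by positivity) _ (by linarith)
      have : 2 / π * |u| = 2 * (|u| / π) := by ring
      linarith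


lemma aux_area : ∃ M : ℝ, 0 ≤ M ∧ ∀ ζ : ℂ, ‖ζ‖ = 1 →
    ∫⁻ z in ball (0:ℂ) 1, ENNReal.ofReal (‖ζ - z‖ ^ (-(3/2) : ℝ)) ≤ ENNReal.ofReal M := by
  set f : ℝ → ℝ := Set.indicator (Set.Iio 2) (fun r => r ^ (-(3/2):ℝ)) with hf
  have hI : Integrable (fun w : ℂ => f ‖w‖) := by
    rw [integrable_fun_norm_addHaar]
    have h1 : IntegrableOn (fun y : ℝ => y ^ (-(1/2):ℝ)) (Set.Ioo 0 2) := by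
      have := intervalIntegral.intervalIntegrable_rpow' (a := 0) (b := 2) (r := -(1/2)) (by norm_num)
      rw [intervalIntegrable_iff_integrableOn_Ioo_of_le (by norm_num)] at this
      exact this
    have h2 : IntegrableOn (Set.indicator (Set.Iio 2) (fun y : ℝ => y ^ (-(1/2):ℝ))) (Set.Ioi 0) := by
      rw [IntegrableOn, integrable_indicator_iff measurableSet_Iio, IntegrableOn, Measure.restrict_restrict measurableSet_Iio]
      rw [Set.inter_comm, Set.Ioi_inter_Iio]; exact h1
    refine h2.congr_fun ?_ measurableSet_Ioi
    intro y hy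
    have hy : 0 < y := hy
    by_cases h : y ∈ Set.Iio (2:ℝ)
    · simp only [hf, Set.indicator_of_mem h, Complex.finrank_real_complex, smul_eq_mul]
      rw [show -(1/2:ℝ) = 1 + -(3/2) by norm_num, rpow_add hy]; simp
    · simp [hf, Set.indicator_of_notMem h]
  have hf0 : ∀ r, 0 ≤ r → 0 ≤ f r := by
    intro r hr
    simp only [hf, Set.indicator]
    split_ifs
    · exact rpow_nonneg hr _
    · exact le_rfl
  refine ⟨∫ w : ℂ, f ‖w‖, integral_nonneg (fun w => hf0 _ (norm_nonneg _)), ?_⟩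
  intro ζ hζ
  rw [ofReal_integral_eq_lintegral_ofReal hI (Filter.Eventually.of_forall fun w => hf0 _ (norm_nonneg _))]
  rw [← lintegral_sub_left_eq_self (fun w : ℂ => ENNReal.ofReal (f ‖w‖)) ζ]
  rw [← lintegral_indicator measurableSet_ball]
  apply lintegral_mono
  intro z
  by_cases h : z ∈ ball (0:ℂ) 1
  · have hz : ‖z‖ < 1 := by simpa using h
    have : ‖ζ - z‖ ∈ Set.Iio (2:ℝ) := by
      have := norm_sub_le ζ z
      simp only [Set.mem_Iio]; linarith
    simp only [Set.indicator_of_mem h, hf, Set.indicator_of_mem this]; exact le_rfl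
  · simp [Set.indicator_of_notMem h]

lemma aux_holder (p : ℝ) (hp : 1 ≤ p) : ∃ M : ℝ, 0 ≤ M ∧ ∀ h : ℝ → ℝ, Continuous h →
    (∀ φ, 0 ≤ h φ) → ∀ z ∈ ball (0:ℂ) 1,
    (∫ φ in (0:ℝ)..(2*π), h φ * ‖circleMap 0 1 φ - z‖⁻¹) ^ p ≤
      M * ∫ φ in (0:ℝ)..(2*π), h φ ^ p * ‖circleMap 0 1 φ - z‖ ^ (-(3/2) : ℝ) := by
  have hcont : ∀ s : ℝ, ∀ z ∈ ball (0:ℂ) 1, Continuous fun φ => ‖circleMap 0 1 φ - z‖ ^ s := by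
    intro s z hz
    exact ((continuous_circleMap 0 1).sub continuous_const).norm.rpow_const
      (fun φ => Or.inl (aux_pos hz φ).ne')
  rcases hp.eq_or_lt with rfl | hp1
  · refine ⟨2 ^ (1/2 : ℝ), by positivity, ?_⟩
    intro h hc h0 z hz
    rw [rpow_one, ← intervalIntegral.integral_const_mul]
    have hk := hcont (-1) z hz
    have hk2 := hcont (-(3/2)) z hz
    simp only [rpow_one]
    simp only [rpow_neg_one] at hk
    apply intervalIntegral.integral_mono_on (by positivity)
      ((hc.mul hk).intervalIntegrable _ _) 
      ((continuous_const.mul (hc.mul hk2)).intervalIntegrable _ _)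
    intro φ _
    have hpos := aux_pos hz φ
    have h2 := aux_le_two hz φ
    set r := ‖circleMap 0 1 φ - z‖
    have h3 : r⁻¹ = r ^ (1/2:ℝ) * r ^ (-(3/2):ℝ) := by
      rw [← rpow_add hpos, ← rpow_neg_one]; norm_num
    have h4 : r ^ (1/2:ℝ) ≤ 2 ^ (1/2:ℝ) := rpow_le_rpow hpos.le h2 (by norm_num)
    change h φ * r⁻¹ ≤ 2 ^ (1/2:ℝ) * (h φ * r ^ (-(3/2):ℝ))
    rw [h3]
    have h5 : 0 ≤ h φ * r ^ (-(3/2):ℝ) := mul_nonneg (h0 φ) (by positivity)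
    nlinarith
  · set q := p.conjExponent with hq
    have hpq : p.HolderConjugate q := Real.HolderConjugate.conjExponent hp1
    have hp0 : 0 < p := by linarith
    have hq0 : 0 < q := hpq.symm.pos
    have hp1' : 0 < p - 1 := by linarith
    have hqe : q = p / (p - 1) := rfl
    obtain ⟨M, hM0, hM⟩ := aux_circle_int ((1 - 3/(2*p)) * q) (by
      rw [hqe]
      have : (1 - 3/(2*p)) * (p / (p-1)) = (p - 3/2)/(p-1) := by field_simp
      rw [this, div_lt_one hp1']; linarith)
    refine ⟨M ^ (p / q), by positivity, ?_⟩
    intro h hc h0 z hz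
    set f : ℝ → ℝ := fun φ => h φ * ‖circleMap 0 1 φ - z‖ ^ (-(3/(2*p)))
    set g : ℝ → ℝ := fun φ => ‖circleMap 0 1 φ - z‖ ^ (-(1 - 3/(2*p)))
    have hfc : Continuous f := hc.mul (hcont _ z hz)
    have hgc : Continuous g := hcont _ z hz
    have hf0 : ∀ φ, 0 ≤ f φ := fun φ => mul_nonneg (h0 φ) (rpow_nonneg (norm_nonneg _) _)
    have hg0 : ∀ φ, 0 ≤ g φ := fun φ => rpow_nonneg (norm_nonneg _) _
    have hmem : ∀ k : ℝ → ℝ, Continuous k → ∀ s : ℝ,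
        MemLp k (ENNReal.ofReal s) (volume.restrict (Set.Ioc 0 (2*π))) := by
      intro k hk s
      obtain ⟨B, hB⟩ := (isCompact_Icc (a := (0:ℝ)) (b := 2*π)).exists_bound_of_continuousOn
        hk.continuousOn
      apply MemLp.of_bound hk.aestronglyMeasurable B
      filter_upwards [ae_restrict_mem measurableSet_Ioc] with φ hφ
      exact hB φ (Set.Ioc_subset_Icc_self hφ)
    have key := integral_mul_le_Lp_mul_Lq_of_nonneg (μ := volume.restrict (Set.Ioc 0 (2*π))) hpq
      (Filter.Eventually.of_forall hf0) (Filter.Eventually.of_forall hg0) (hmem f hfc p) (hmem g hgc q)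
    simp only [← intervalIntegral.integral_of_le two_pi_pos.le] at key
    have e1 : (fun φ => f φ * g φ) = fun φ => h φ * ‖circleMap 0 1 φ - z‖⁻¹ := by
      ext φ
      simp only [f, g]
      rw [mul_assoc, ← rpow_add (aux_pos hz φ), ← rpow_neg_one]
      congr 2; ring
    have e2 : (fun φ => f φ ^ p) = fun φ => h φ ^ p * ‖circleMap 0 1 φ - z‖ ^ (-(3/2):ℝ) := by
      ext φ
      simp only [f]
      rw [mul_rpow (h0 φ) (rpow_nonneg (norm_nonneg _) _), ← rpow_mul (norm_nonneg _)]
      congr 2; field_simp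
    have e3 : (fun φ => g φ ^ q) = fun φ => ‖circleMap 0 1 φ - z‖ ^ (-((1 - 3/(2*p)) * q)) := by
      ext φ
      simp only [g]
      rw [← rpow_mul (norm_nonneg _), neg_mul]
    rw [e1, e2, e3] at key
    have hI0 : 0 ≤ ∫ φ in (0:ℝ)..(2*π), h φ * ‖circleMap 0 1 φ - z‖⁻¹ :=
      intervalIntegral.integral_nonneg two_pi_pos.le
        fun φ _ => mul_nonneg (h0 φ) (inv_nonneg.2 (norm_nonneg _))
    have hJ0 : 0 ≤ ∫ φ in (0:ℝ)..(2*π), h φ ^ p * ‖circleMap 0 1 φ - z‖ ^ (-(3/2):ℝ) :=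
      intervalIntegral.integral_nonneg two_pi_pos.le
        fun φ _ => mul_nonneg (rpow_nonneg (h0 φ) _) (rpow_nonneg (norm_nonneg _) _)
    have hK0 : 0 ≤ ∫ φ in (0:ℝ)..(2*π), ‖circleMap 0 1 φ - z‖ ^ (-((1 - 3/(2*p)) * q)) :=
      intervalIntegral.integral_nonneg two_pi_pos.le
        fun φ _ => rpow_nonneg (norm_nonneg _) _
    calc _ ≤ _ := rpow_le_rpow hI0 key hp0.le
      _ = (∫ φ in (0:ℝ)..(2*π), h φ ^ p * ‖circleMap 0 1 φ - z‖ ^ (-(3/2):ℝ)) *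
          (∫ φ in (0:ℝ)..(2*π), ‖circleMap 0 1 φ - z‖ ^ (-((1 - 3/(2*p)) * q))) ^ (p/q) := by
        rw [mul_rpow (by positivity) (by positivity), ← rpow_mul hJ0, ← rpow_mul hK0,
          one_div_mul_cancel hp0.ne', rpow_one]
        congr 2; ring
      _ ≤ (∫ φ in (0:ℝ)..(2*π), h φ ^ p * ‖circleMap 0 1 φ - z‖ ^ (-(3/2):ℝ)) * M ^ (p/q) := by
        gcongr
        exact hM z hz
      _ = _ := mul_comm _ _

lemma aux_complex (p : ℝ) (hp : 1 ≤ p) : ∃ C : ℝ, 0 ≤ C ∧ ∀ F : ℂ → ℂ,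
    ContinuousOn F (closedBall 0 1) → DifferentiableOn ℂ F (ball 0 1) →
    ∫ z in ball (0:ℂ) 1, ‖F z‖ ^ p ≤
      C * ∫ φ in (0:ℝ)..(2*π), |(circleMap 0 1 φ * F (circleMap 0 1 φ)).im| ^ p := by
  obtain ⟨M, hM0, hM⟩ := aux_holder p hp
  obtain ⟨N, hN0, hN⟩ := aux_area
  refine ⟨M * N, by positivity, ?_⟩
  intro F hc hd
  have hp0 : 0 ≤ p := by linarith
  set h : ℝ → ℝ := fun φ => |(circleMap 0 1 φ * F (circleMap 0 1 φ)).im| with hh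
  have hγc : Continuous (circleMap 0 1) := continuous_circleMap 0 1
  have hFc : Continuous (fun φ => F (circleMap 0 1 φ)) :=
    hc.comp_continuous hγc (fun φ => circleMap_mem_closedBall _ zero_le_one φ)
  have hhc : Continuous h := (Complex.continuous_im.comp (hγc.mul hFc)).abs
  have hh0 : ∀ φ, 0 ≤ h φ := fun φ => abs_nonneg _
  have hhp : Continuous fun φ => h φ ^ p := hhc.rpow_const (fun _ => Or.inr hp0)
  have hpt : ∀ z ∈ ball (0:ℂ) 1, ‖F z‖ ^ p ≤
      M * ∫ φ in (0:ℝ)..(2*π), h φ ^ p * ‖circleMap 0 1 φ - z‖ ^ (-(3/2) : ℝ) := by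
    intro z hz
    refine le_trans ?_ (hM h hhc hh0 z hz)
    apply rpow_le_rpow (norm_nonneg _) _ hp0
    refine le_trans ?_ (aux_schwarz F hc hd hz)
    have : 1 ≤ π := by linarith [pi_gt_three]
    nlinarith [norm_nonneg (F z)]
  have hJ0 : 0 ≤ ∫ φ in (0:ℝ)..(2*π), h φ ^ p :=
    intervalIntegral.integral_nonneg two_pi_pos.le fun φ _ => rpow_nonneg (hh0 φ) _
  have hFp : ContinuousOn (fun z => ‖F z‖ ^ p) (ball 0 1) :=
    (hc.mono ball_subset_closedBall).norm.rpow_const (fun _ _ => Or.inr hp0)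
  rw [integral_eq_lintegral_of_nonneg_ae (Filter.Eventually.of_forall fun z => by positivity)
    (hFp.aestronglyMeasurable measurableSet_ball)]
  apply ENNReal.toReal_le_of_le_ofReal (by positivity)
  have hofJ : ENNReal.ofReal (∫ φ in (0:ℝ)..(2*π), h φ ^ p) =
      ∫⁻ φ in Set.Ioc 0 (2*π), ENNReal.ofReal (h φ ^ p) := by
    rw [intervalIntegral.integral_of_le two_pi_pos.le, ofReal_integral_eq_lintegral_ofReal]
    · exact (hhp.intervalIntegrable 0 (2*π)).1
    · exact Filter.Eventually.of_forall fun φ => rpow_nonneg (hh0 φ) _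
  calc ∫⁻ z in ball (0:ℂ) 1, ENNReal.ofReal (‖F z‖ ^ p)
      ≤ ∫⁻ z in ball (0:ℂ) 1, ENNReal.ofReal M * ∫⁻ φ in Set.Ioc 0 (2*π), 
          ENNReal.ofReal (h φ ^ p) * ENNReal.ofReal (‖circleMap 0 1 φ - z‖ ^ (-(3/2) : ℝ)) := by
        apply setLIntegral_mono' measurableSet_ball
        intro z hz
        refine (ENNReal.ofReal_le_ofReal (hpt z hz)).trans ?_
        have hK : Continuous fun φ => ‖circleMap 0 1 φ - z‖ ^ (-(3/2) : ℝ) :=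
          ((continuous_circleMap 0 1).sub continuous_const).norm.rpow_const
            (fun φ => Or.inl (aux_pos hz φ).ne')
        rw [ENNReal.ofReal_mul hM0, intervalIntegral.integral_of_le two_pi_pos.le,
          ofReal_integral_eq_lintegral_ofReal]
        · simp only [ENNReal.ofReal_mul (rpow_nonneg (hh0 _) p)]
          exact le_rfl
        · exact ((hhp.mul hK).intervalIntegrable 0 (2*π)).1
        · exact Filter.Eventually.of_forall fun φ =>
            mul_nonneg (rpow_nonneg (hh0 φ) _) (rpow_nonneg (norm_nonneg _) _)
    _ = ENNReal.ofReal M * ∫⁻ φ in Set.Ioc 0 (2*π), ∫⁻ z in ball (0:ℂ) 1,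
          ENNReal.ofReal (h φ ^ p) * ENNReal.ofReal (‖circleMap 0 1 φ - z‖ ^ (-(3/2) : ℝ)) := by
        rw [lintegral_const_mul' _ _ ENNReal.ofReal_ne_top, lintegral_lintegral_swap]
        apply Measurable.aemeasurable
        have h1 := hhp.measurable
        have h2 := hγc.measurable
        simp only [Function.uncurry_def]
        fun_prop
    _ ≤ ENNReal.ofReal M * ∫⁻ φ in Set.Ioc 0 (2*π), ENNReal.ofReal (h φ ^ p) * ENNReal.ofReal N := by
        gcongr with φ
        rw [lintegral_const_mul' _ _ ENNReal.ofReal_ne_top]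
        gcongr
        exact hN _ (by simp)
    _ = ENNReal.ofReal (M * N * ∫ φ in (0:ℝ)..(2*π), h φ ^ p) := by
        rw [lintegral_mul_const' _ _ ENNReal.ofReal_ne_top, ← hofJ,
          ENNReal.ofReal_mul (by positivity), ENNReal.ofReal_mul hM0]
        ring

lemma aux_haus_half (c : ℝ → EuclideanSpace ℝ (Fin 2))
    (hc : ∀ φ, c φ = Complex.orthonormalBasisOneI.repr (circleMap 0 1 φ)) (a : ℝ)
    (S : Set (EuclideanSpace ℝ (Fin 2))) :
    volume (c ⁻¹' S ∩ Set.Icc a (a + π)) ≤ 2 * μH[1] S := by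
  set f : Set.Icc a (a + π) → EuclideanSpace ℝ (Fin 2) := fun x => c x
  have hf : AntilipschitzWith 2 f := by
    apply AntilipschitzWith.of_le_mul_dist
    rintro ⟨x, hx⟩ ⟨y, hy⟩
    have hxy : |x - y| ≤ π := by
      rw [abs_le]; constructor <;> linarith [hx.1, hx.2, hy.1, hy.2]
    have h1 := aux_chord x y hxy
    simp only [f, hc, Subtype.dist_eq, Real.dist_eq]
    rw [LinearIsometryEquiv.dist_map, dist_eq_norm]
    have h2 : 1 / 2 ≤ 2 / π := by
      rw [div_le_div_iff₀ (by norm_num) pi_pos]; linarith [pi_lt_four]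
    have h3 : 1 / 2 * |x - y| ≤ 2 / π * |x - y| := by gcongr
    push_cast
    linarith
  have h1 := hf.hausdorffMeasure_preimage_le zero_le_one S
  have h2 := (isometry_subtype_coe (s := Set.Icc a (a + π))).hausdorffMeasure_image (d := 1)
    (Or.inl zero_le_one) (f ⁻¹' S)
  have h3 : ((↑) : Set.Icc a (a + π) → ℝ) '' (f ⁻¹' S) = c ⁻¹' S ∩ Set.Icc a (a + π) := by
    ext x
    simp only [Set.mem_image, Set.mem_preimage, Set.mem_inter_iff, f]
    constructor
    · rintro ⟨y, hy, rfl⟩; exact ⟨hy, y.2⟩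
    · rintro ⟨hx, hx'⟩; exact ⟨⟨x, hx'⟩, hx, rfl⟩
  rw [← hausdorffMeasure_real, ← h3, h2]
  simpa using h1

lemma aux_haus (f : EuclideanSpace ℝ (Fin 2) → ℝ) (hf : ContinuousOn f (sphere 0 1))
    (hf0 : ∀ y, 0 ≤ f y) :
    ∫ φ in (0:ℝ)..(2*π), f (Complex.orthonormalBasisOneI.repr (circleMap 0 1 φ)) ≤
      4 * ∫ y in sphere (0 : EuclideanSpace ℝ (Fin 2)) 1, f y ∂μH[1] := by
  set c : ℝ → EuclideanSpace ℝ (Fin 2) :=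
    fun φ => Complex.orthonormalBasisOneI.repr (circleMap 0 1 φ) with hc
  have hcc : Continuous c := by fun_prop
  have hcs : ∀ φ, c φ ∈ sphere (0 : EuclideanSpace ℝ (Fin 2)) 1 := by
    intro φ; simp [hc]
  have hle : Measure.map c (volume.restrict (Set.Ioc 0 (2*π))) ≤
      (4 : NNReal) • (μH[1] : Measure (EuclideanSpace ℝ (Fin 2))).restrict (sphere 0 1) := by
    rw [Measure.le_iff]
    intro S hS
    rw [Measure.map_apply hcc.measurable hS, Measure.restrict_apply (hcc.measurable hS),
      Measure.smul_apply, Measure.restrict_apply hS]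
    have hsub : c ⁻¹' S ∩ Set.Ioc 0 (2*π) ⊆ (c ⁻¹' (S ∩ sphere 0 1) ∩ Set.Icc 0 (0 + π)) ∪
        (c ⁻¹' (S ∩ sphere 0 1) ∩ Set.Icc π (π + π)) := by
      rintro x ⟨hx, hx1, hx2⟩
      rcases le_total x π with h | h
      · exact Or.inl ⟨⟨hx, hcs x⟩, hx1.le, by linarith⟩
      · exact Or.inr ⟨⟨hx, hcs x⟩, h, by linarith⟩
    refine (measure_mono hsub).trans ((measure_union_le _ _).trans ?_)
    refine (add_le_add (aux_haus_half c (fun _ => rfl) 0 _)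
      (aux_haus_half c (fun _ => rfl) π _)).trans ?_
    rw [← add_mul]
    norm_num
  have hfin : (μH[1] : Measure (EuclideanSpace ℝ (Fin 2))) (sphere 0 1) < ⊤ := by
    have hl : LipschitzWith 1 c := by
      have := Complex.orthonormalBasisOneI.repr.lipschitz.comp (lipschitzWith_circleMap 0 1)
      rw [map_one, mul_one] at this
      exact this
    have h1 := hl.hausdorffMeasure_image_le (d := 1) zero_le_one (Set.Icc (-π) π)
    have h2 : sphere (0 : EuclideanSpace ℝ (Fin 2)) 1 ⊆ c '' Set.Icc (-π) π := by
      intro y hy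
      obtain ⟨w, rfl⟩ := Complex.orthonormalBasisOneI.repr.surjective y
      have hw : ‖w‖ = 1 := by simpa using hy
      refine ⟨Complex.arg w, ⟨(Complex.neg_pi_lt_arg w).le, Complex.arg_le_pi w⟩, ?_⟩
      simp only [hc]
      congr 1
      have := Complex.norm_mul_exp_arg_mul_I w
      rw [hw] at this
      simpa [circleMap] using this
    refine (measure_mono h2).trans_lt (h1.trans_lt ?_)
    rw [hausdorffMeasure_real, Real.volume_Icc]
    simp
  have hint : IntegrableOn f (sphere 0 1) (μH[1] : Measure (EuclideanSpace ℝ (Fin 2))) := by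
    obtain ⟨B, hB⟩ := (isCompact_sphere (0 : EuclideanSpace ℝ (Fin 2)) 1).exists_bound_of_continuousOn hf
    exact IntegrableOn.of_bound hfin
      (hf.aestronglyMeasurable isClosed_sphere.measurableSet) B
      (by filter_upwards [ae_restrict_mem isClosed_sphere.measurableSet] with y hy using hB y hy)
  have hmono := integral_mono_measure hle (Filter.Eventually.of_forall hf0)
    (hint.smul_measure_nnreal)
  rw [integral_smul_nnreal_measure, integral_map hcc.aemeasurable] at hmono
  · rw [intervalIntegral.integral_of_le two_pi_pos.le]
    simpa [NNReal.smul_def] using hmono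
  · exact ((hint.smul_measure_nnreal (c := 4)).mono_measure hle).aestronglyMeasurable

lemma aux_grad_norm (A : EuclideanSpace ℝ (Fin 2) → ℝ) (x : EuclideanSpace ℝ (Fin 2)) :
    ‖gradient A x‖ = ‖((fderiv ℝ A x (EuclideanSpace.single 0 1) : ℝ) : ℂ) -
      Complex.I * ((fderiv ℝ A x (EuclideanSpace.single 1 1) : ℝ) : ℂ)‖ := by
  have h : ∀ i, gradient A x i = fderiv ℝ A x (EuclideanSpace.single i 1) := by
    intro i
    rw [← InnerProductSpace.toDual_symm_apply (𝕜 := ℝ), EuclideanSpace.inner_single_right]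
    simp [gradient]
  rw [EuclideanSpace.norm_eq, Fin.sum_univ_two, h 0, h 1, Complex.norm_eq_sqrt_sq_add_sq]
  simp

lemma aux_inner (A : EuclideanSpace ℝ (Fin 2) → ℝ) (x y : EuclideanSpace ℝ (Fin 2)) :
    ⟪gradient A x, EuclideanSpace.single 0 (-(y 1)) + EuclideanSpace.single 1 (y 0)⟫ =
      - y 1 * fderiv ℝ A x (EuclideanSpace.single 0 1) +
        y 0 * fderiv ℝ A x (EuclideanSpace.single 1 1) := by
  have h : ∀ (i : Fin 2) (r : ℝ), (EuclideanSpace.single i r : EuclideanSpace ℝ (Fin 2)) =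
      r • EuclideanSpace.single i 1 := by
    intro i r; ext j; by_cases hj : j = i <;> simp [hj]
  rw [gradient, InnerProductSpace.toDual_symm_apply, h 0 (-(y 1)), h 1 (y 0), map_add, map_smul,
    map_smul]
  simp

lemma aux_repr_one : Complex.orthonormalBasisOneI.repr 1 = EuclideanSpace.single 0 1 := by
  ext j; fin_cases j <;> simp

lemma aux_repr_I : Complex.orthonormalBasisOneI.repr Complex.I = EuclideanSpace.single 1 1 := by
  ext j; fin_cases j <;> simp

lemma aux_holo (A : EuclideanSpace ℝ (Fin 2) → ℝ)
    (h2 : ContDiffOn ℝ 2 A (ball (0 : EuclideanSpace ℝ (Fin 2)) 1))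
    (hh : ∀ x ∈ ball (0 : EuclideanSpace ℝ (Fin 2)) 1,
          fderiv ℝ (fun y => fderiv ℝ A y (EuclideanSpace.single 0 1)) x
              (EuclideanSpace.single 0 1)
            + fderiv ℝ (fun y => fderiv ℝ A y (EuclideanSpace.single 1 1)) x
              (EuclideanSpace.single 1 1) = 0) :
    DifferentiableOn ℂ (fun z : ℂ => 
      ((fderiv ℝ A (Complex.orthonormalBasisOneI.repr z) (EuclideanSpace.single 0 1) : ℝ) : ℂ) -
      Complex.I * ((fderiv ℝ A (Complex.orthonormalBasisOneI.repr z) (EuclideanSpace.single 1 1) : ℝ) : ℂ)) (ball 0 1) := by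
  set E := Complex.orthonormalBasisOneI.repr with hE
  set a : ℂ → ℝ := fun z => A (E z) with ha
  have hmem : ∀ z ∈ ball (0:ℂ) 1, E z ∈ ball (0 : EuclideanSpace ℝ (Fin 2)) 1 := by
    intro z hz; simpa using hz
  have hfd : ∀ z v, fderiv ℝ a z v = fderiv ℝ A (E z) (E v) := by
    intro z v
    have := E.toContinuousLinearEquiv.comp_right_fderiv (f := A) (x := z)
    have h' : fderiv ℝ a z = (fderiv ℝ A (E z)).comp (E.toContinuousLinearEquiv : ℂ →L[ℝ] _) := this
    rw [h']; rfl
  have hA : ∀ z ∈ ball (0:ℂ) 1, ContDiffAt ℝ 2 A (E z) := fun z hz =>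
    h2.contDiffAt (isOpen_ball.mem_nhds (hmem z hz))
  have hac : ∀ z ∈ ball (0:ℂ) 1, ContDiffAt ℝ 2 a z := fun z hz =>
    (hA z hz).comp z E.toContinuousLinearEquiv.contDiff.contDiffAt
  have hsec : ∀ z ∈ ball (0:ℂ) 1, ∀ v, fderiv ℝ (fderiv ℝ a) z v v =
      fderiv ℝ (fun y => fderiv ℝ A y (E v)) (E z) (E v) := by
    intro z hz v
    have hd : DifferentiableAt ℝ (fderiv ℝ a) z :=
      ((hac z hz).fderiv_right (m := 1) (by norm_num)).differentiableAt (by norm_num)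
    have hdA : DifferentiableAt ℝ (fderiv ℝ A) (E z) :=
      ((hA z hz).fderiv_right (m := 1) (by norm_num)).differentiableAt (by norm_num)
    have e1 : fderiv ℝ (fun w => fderiv ℝ a w v) z v = fderiv ℝ (fderiv ℝ a) z v v := by
      rw [fderiv_clm_apply hd (by fun_prop)]; simp
    rw [← e1]
    have e2 : (fun w => fderiv ℝ a w v) = (fun y => fderiv ℝ A y (E v)) ∘ E.toContinuousLinearEquiv := by
      ext w; exact hfd w v
    rw [e2, ContinuousLinearEquiv.comp_right_fderiv]; rfl
  have hharm : ∀ z ∈ ball (0:ℂ) 1, InnerProductSpace.HarmonicAt a z := by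
    intro z hz
    refine ⟨hac z hz, ?_⟩
    filter_upwards [isOpen_ball.mem_nhds hz] with w hw
    rw [InnerProductSpace.laplacian_eq_iteratedFDeriv_complexPlane]
    simp only [iteratedFDeriv_two_apply]
    simp only [Matrix.cons_val_zero, Matrix.cons_val_one, hsec w hw, Pi.zero_apply]
    rw [hE, aux_repr_one, aux_repr_I]
    exact hh _ (hmem w hw)
  intro z hz
  have := (HarmonicAt.differentiableAt_complex_partial (hharm z hz)).differentiableWithinAt (s := ball 0 1)
  simp only [hfd] at this
  rw [hE, aux_repr_one, aux_repr_I] at this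
  exact this

/-- For `1 ≤ p < ∞` there is `C = C(p) > 0` such that: if `A : ℝ² → ℝ` is `C¹` on an
open neighborhood of the closed unit ball and harmonic on the open unit ball (here we
ask `A` to be twice continuously differentiable on the ball, with vanishing Laplacian
`∂²A/∂x₁² + ∂²A/∂x₂² = 0` there), then
`∫_{B²} ‖∇A‖^p ≤ C ∫_{S¹} |⟨∇A(y), (−y₂, y₁)⟩|^p dH¹(y)`, i.e. the `L^p` norm of the
gradient on the disc is controlled by the `L^p` norm of the tangential derivative of
the boundary values. -/
theorem harmonic_gradient_Lp_boundary_estimate (p : ℝ) (hp : 1 ≤ p) :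
    ∃ C : ℝ, 0 < C ∧
      ∀ (A : EuclideanSpace ℝ (Fin 2) → ℝ) (U : Set (EuclideanSpace ℝ (Fin 2))),
        IsOpen U → closedBall (0 : EuclideanSpace ℝ (Fin 2)) 1 ⊆ U →
        ContDiffOn ℝ 1 A U →
        ContDiffOn ℝ 2 A (ball (0 : EuclideanSpace ℝ (Fin 2)) 1) →
        (∀ x ∈ ball (0 : EuclideanSpace ℝ (Fin 2)) 1,
          fderiv ℝ (fun y => fderiv ℝ A y (EuclideanSpace.single 0 1)) x
              (EuclideanSpace.single 0 1)
            + fderiv ℝ (fun y => fderiv ℝ A y (EuclideanSpace.single 1 1)) x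
              (EuclideanSpace.single 1 1) = 0) →
        (∫ x in ball (0 : EuclideanSpace ℝ (Fin 2)) 1, ‖gradient A x‖ ^ p)
          ≤ C * ∫ y in sphere (0 : EuclideanSpace ℝ (Fin 2)) 1,
              |⟪gradient A y,
                EuclideanSpace.single 0 (-(y 1)) + EuclideanSpace.single 1 (y 0)⟫| ^ p
                ∂μH[1] := by
  obtain ⟨C, hC0, hC⟩ := aux_complex p hp
  refine ⟨C * 4 + 1, by positivity, ?_⟩
  intro A U hU hsub h1 h2 hh
  have hp0 : 0 ≤ p := by linarith
  set E := Complex.orthonormalBasisOneI.repr with hE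
  set F : ℂ → ℂ := fun z => ((fderiv ℝ A (E z) (EuclideanSpace.single 0 1) : ℝ) : ℂ) -
      Complex.I * ((fderiv ℝ A (E z) (EuclideanSpace.single 1 1) : ℝ) : ℂ) with hF
  have hdc : ContinuousOn (fderiv ℝ A) U := h1.continuousOn_fderiv_of_isOpen hU le_rfl
  have hv : ∀ v, ContinuousOn (fun x => fderiv ℝ A x v) (closedBall 0 1) := fun v =>
    (hdc.mono hsub).clm_apply continuousOn_const
  have hEv : ∀ v, ContinuousOn (fun z => fderiv ℝ A (E z) v) (closedBall (0:ℂ) 1) := fun v =>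
    (hv v).comp E.continuous.continuousOn (fun z hz => by simpa using hz)
  have hFc : ContinuousOn F (closedBall 0 1) :=
    (Complex.continuous_ofReal.comp_continuousOn (hEv _)).sub
      (continuousOn_const.mul (Complex.continuous_ofReal.comp_continuousOn (hEv _)))
  have key := hC F hFc (aux_holo A h2 hh)
  have hL : ∫ x in ball (0 : EuclideanSpace ℝ (Fin 2)) 1, ‖gradient A x‖ ^ p =
      ∫ z in ball (0:ℂ) 1, ‖F z‖ ^ p := by
    rw [← E.measurePreserving.setIntegral_preimage_emb
      E.toHomeomorph.measurableEmbedding]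
    simp only [aux_grad_norm]
    rw [E.preimage_ball, map_zero]
  set f : EuclideanSpace ℝ (Fin 2) → ℝ := fun y => |⟪gradient A y,
                EuclideanSpace.single 0 (-(y 1)) + EuclideanSpace.single 1 (y 0)⟫| ^ p with hf
  have hf0 : ∀ y, 0 ≤ f y := fun y => by positivity
  have hfc : ContinuousOn f (sphere 0 1) := by
    simp only [hf, aux_inner]
    apply ContinuousOn.rpow_const _ (fun _ _ => Or.inr hp0)
    have ha := (hv (EuclideanSpace.single 0 1)).mono (sphere_subset_closedBall)
    have hb := (hv (EuclideanSpace.single 1 1)).mono (sphere_subset_closedBall)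
    exact (((by fun_prop : Continuous fun y : EuclideanSpace ℝ (Fin 2) => -y 1).continuousOn.mul ha).add
      ((by fun_prop : Continuous fun y : EuclideanSpace ℝ (Fin 2) => y 0).continuousOn.mul hb)).abs
  have hR : ∀ φ, |(circleMap 0 1 φ * F (circleMap 0 1 φ)).im| ^ p = f (E (circleMap 0 1 φ)) := by
    intro φ
    simp only [hf, aux_inner, hF]
    rw [← abs_neg]
    congr 2
    simp [hE]
  have hh2 := aux_haus f hfc hf0
  simp only [hR] at key
  rw [hL]
  have hI0 : 0 ≤ ∫ y in sphere (0 : EuclideanSpace ℝ (Fin 2)) 1, f y ∂μH[1] :=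
    integral_nonneg hf0
  have := mul_le_mul_of_nonneg_left hh2 hC0
  linarith
end

section
/- Let 1 < p < 2. There is a constant C = C(p) > 0 with the following property. Let ε > 0, let x₀ ∈ ℝ², and let V : B_ε(x₀) → ℝ² be integrable with ∫_{B_ε(x₀)} ‖V‖^p dx < ∞, and suppose that the distributional divergence of V equals the Dirac mass at x₀, i.e., ∫_{B_ε(x₀)} ⟨V(x), ∇φ(x)⟩ dx = −φ(x₀) for every smooth compactly supported φ : ℝ² → ℝ with support contained in B_ε(x₀). Then ∫_{B_ε(x₀)} ‖V(x)‖^p dx ≥ C ε^{2−p}. -/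
open MeasureTheory Metric Real RealInnerProductSpace

/-- For `1 < p < 2` there is `C = C(p) > 0` such that: if `V` is an integrable vector
field on `B_ε(x₀)` with `∫_{B_ε(x₀)} ‖V‖^p < ∞` whose distributional divergence is the
Dirac mass at `x₀` (i.e. `∫ ⟨V, ∇φ⟩ = −φ(x₀)` for all smooth compactly supported test
functions `φ` with support in `B_ε(x₀)`), then `∫_{B_ε(x₀)} ‖V‖^p ≥ C ε^{2−p}`. -/
theorem dirac_divergence_Lp_lower_bound (p : ℝ) (hp1 : 1 < p) (hp2 : p < 2) :
    ∃ C : ℝ, 0 < C ∧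
      ∀ (ε : ℝ), 0 < ε →
      ∀ (x₀ : EuclideanSpace ℝ (Fin 2))
        (V : EuclideanSpace ℝ (Fin 2) → EuclideanSpace ℝ (Fin 2)),
        IntegrableOn V (ball x₀ ε) volume →
        IntegrableOn (fun x => ‖V x‖ ^ p) (ball x₀ ε) volume →
        (∀ φ : EuclideanSpace ℝ (Fin 2) → ℝ, ContDiff ℝ (⊤ : ℕ∞) φ → HasCompactSupport φ →
          tsupport φ ⊆ ball x₀ ε →
          (∫ x in ball x₀ ε, ⟪V x, gradient φ x⟫) = -φ x₀) →
        C * ε ^ (2 - p) ≤ ∫ x in ball x₀ ε, ‖V x‖ ^ p := by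
  classical
  let b : ContDiffBump (0 : EuclideanSpace ℝ (Fin 2)) :=
    ⟨1/4, 1/2, by norm_num, by norm_num⟩
  have hbs : ContDiff ℝ (⊤ : ℕ∞) (b : EuclideanSpace ℝ (Fin 2) → ℝ) := b.contDiff
  obtain ⟨M0, hM0⟩ := (b.hasCompactSupport.fderiv (𝕜 := ℝ)).exists_bound_of_continuous
    (hbs.continuous_fderiv (by simp))
  set M := max M0 1 with hM
  have hMpos : 0 < M := lt_of_lt_of_le one_pos (le_max_right _ _)
  have hMb : ∀ x, ‖fderiv ℝ (b : EuclideanSpace ℝ (Fin 2) → ℝ) x‖ ≤ M :=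
    fun x => (hM0 x).trans (le_max_left _ _)
  set A := (volume : Measure (EuclideanSpace ℝ (Fin 2))).real (ball 0 1) with hA
  have hApos : 0 < A := by
    rw [hA, measureReal_def]
    exact ENNReal.toReal_pos (measure_ball_pos _ _ one_pos).ne' measure_ball_lt_top.ne
  refine ⟨1 / (2 * M) * (1 / (2 * M * A)) ^ (p - 1), by positivity, ?_⟩
  intro ε hε x₀ V hV hVp hdiv
  set φ : EuclideanSpace ℝ (Fin 2) → ℝ := fun x => b (ε⁻¹ • (x - x₀)) with hφ
  have hsm : ContDiff ℝ (⊤ : ℕ∞) φ := hbs.comp (by fun_prop)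
  have hts : tsupport φ ⊆ closedBall x₀ (ε / 2) := by
    apply closure_minimal _ isClosed_closedBall
    intro x hx
    by_contra hn
    apply hx
    apply b.zero_of_le_dist
    rw [mem_closedBall, not_le, dist_eq_norm] at hn
    rw [dist_zero_right, norm_smul, norm_inv, Real.norm_of_nonneg hε.le]
    change (1:ℝ)/2 ≤ _
    rw [inv_mul_eq_div, le_div_iff₀ hε]
    linarith
  have hcs : HasCompactSupport φ :=
    (isCompact_closedBall x₀ (ε / 2)).of_isClosed_subset (isClosed_tsupport _) hts
  have h1 := hdiv φ hsm hcs (hts.trans (closedBall_subset_ball (by linarith)))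
  have hφ0 : φ x₀ = 1 := by
    simp only [hφ, sub_self, smul_zero]
    exact b.one_of_mem_closedBall (by simp [b])
  have hgrad : ∀ x, ‖gradient φ x‖ ≤ M / ε := by
    intro x
    have hd : HasFDerivAt φ ((fderiv ℝ b (ε⁻¹ • (x - x₀))).comp
        (ε⁻¹ • ContinuousLinearMap.id ℝ (EuclideanSpace ℝ (Fin 2)))) x :=
      ((hbs.differentiable (by simp)) _).hasFDerivAt.comp x
        (((hasFDerivAt_id x).sub_const x₀).const_smul ε⁻¹)
    rw [gradient, LinearIsometryEquiv.norm_map, hd.fderiv]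
    refine (ContinuousLinearMap.opNorm_comp_le _ _).trans ?_
    rw [div_eq_mul_inv]
    gcongr
    · exact hMb _
    · rw [norm_smul, norm_inv, Real.norm_of_nonneg hε.le]
      exact mul_le_of_le_one_right (by positivity) ContinuousLinearMap.norm_id_le
  set t := 1 / (2 * M * A) / ε with ht
  have htpos : 0 < t := by positivity
  have hpt : ∀ x, ‖⟪V x, gradient φ x⟫‖ ≤ M / ε * (t + t ^ (1 - p) * ‖V x‖ ^ p) := by
    intro x
    have hVt : ‖V x‖ ≤ t + t ^ (1 - p) * ‖V x‖ ^ p := by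
      rcases le_total ‖V x‖ t with h | h
      · have : 0 ≤ t ^ (1 - p) * ‖V x‖ ^ p := by positivity
        linarith
      · have hv : 0 < ‖V x‖ := htpos.trans_le h
        have h2 : ‖V x‖ ^ (1 - p) ≤ t ^ (1 - p) :=
          Real.rpow_le_rpow_of_nonpos htpos h (by linarith)
        calc ‖V x‖ = ‖V x‖ ^ (1 - p) * ‖V x‖ ^ p := by
              rw [← Real.rpow_add hv]; simp
          _ ≤ t ^ (1 - p) * ‖V x‖ ^ p := by gcongr
          _ ≤ _ := by linarith
    calc _ ≤ ‖V x‖ * ‖gradient φ x‖ := norm_inner_le_norm _ _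
      _ ≤ (t + t ^ (1 - p) * ‖V x‖ ^ p) * (M / ε) := by
          gcongr
          exact hgrad x
      _ = _ := by ring
  set I := ∫ x in ball x₀ ε, ‖V x‖ ^ p with hI
  have hvol : (volume : Measure (EuclideanSpace ℝ (Fin 2))).real (ball x₀ ε) = ε ^ 2 * A := by
    rw [measureReal_def, Measure.addHaar_ball _ _ hε.le, ENNReal.toReal_mul,
      ENNReal.toReal_ofReal (by positivity), ← measureReal_def]
    simp [hA]
  have hconst : IntegrableOn (fun _ : EuclideanSpace ℝ (Fin 2) => t) (ball x₀ ε) volume :=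
    integrableOn_const measure_ball_lt_top.ne
  have h2 : 1 ≤ M / ε * (t * (ε ^ 2 * A) + t ^ (1 - p) * I) := by
    calc (1:ℝ) = ‖∫ x in ball x₀ ε, ⟪V x, gradient φ x⟫‖ := by rw [h1, hφ0]; simp
      _ ≤ ∫ x in ball x₀ ε, M / ε * (t + t ^ (1 - p) * ‖V x‖ ^ p) :=
        norm_integral_le_of_norm_le ((hconst.add (hVp.const_mul _)).const_mul _)
          (Filter.Eventually.of_forall hpt)
      _ = _ := by
        rw [integral_const_mul, integral_add hconst (hVp.const_mul _), integral_const_mul,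
          setIntegral_const, hvol, smul_eq_mul]
        ring
  have h3 : M / ε * (t * (ε ^ 2 * A)) = 1 / 2 := by
    rw [ht]; field_simp
  have h4 : 1 / 2 ≤ M / ε * (t ^ (1 - p) * I) := by
    rw [mul_add, h3] at h2; linarith
  have h5 : t ^ (p - 1) * t ^ (1 - p) = 1 := by
    rw [← Real.rpow_add htpos]; simp
  have h6 : ε / (2 * M) * t ^ (p - 1) ≤ I := by
    calc _ = (1 / 2) * (ε / M * t ^ (p - 1)) := by field_simp
      _ ≤ (M / ε * (t ^ (1 - p) * I)) * (ε / M * t ^ (p - 1)) := by gcongr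
      _ = (t ^ (p - 1) * t ^ (1 - p)) * I := by field_simp
      _ = I := by rw [h5, one_mul]
  refine le_trans (le_of_eq ?_) h6
  have h7 : ε ^ (2 - p) = ε / ε ^ (p - 1) := by
    rw [show 2 - p = 1 - (p - 1) by ring, Real.rpow_sub hε, Real.rpow_one]
  rw [ht, Real.div_rpow (by positivity) hε.le, h7]
  ring
end

section
/- Let p > 1. There exist sequences of points (x_i⁻)_{i∈ℕ} and (x_i⁺)_{i∈ℕ} in the open unit ball B² of ℝ² with ∑_{i=1}^∞ ‖x_i⁺ − x_i⁻‖ < ∞, such that NO vector field V : B² → ℝ² with ∫_{B²} ‖V‖^p dx < ∞ satisfies ∫_{B²} ⟨V(x), ∇φ(x)⟩ dx = 2π ∑_{i=1}^∞ ( φ(x_i⁺) − φ(x_i⁻) ) for all smooth compactly supported φ : ℝ² → ℝ with support contained in B². (In other words, the boundary of the integral 1-current I = ∑_i [x_i⁻, x_i⁺] is not the divergence of any L^p vector field, hence not a distributional Jacobian of any W^{1,p}(B², S¹) map.) -/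
open MeasureTheory Metric Real RealInnerProductSpace

abbrev E2 : Type := EuclideanSpace ℝ (Fin 2)

lemma params (p : ℝ) (hp : 1 < p) (k : ℕ) : ∃ (M r : ℝ) (N : ℕ), 1 ≤ M ∧ 0 < r ∧
    r < (1/2)^k / 4 ∧ M * r^2 ≤ (1/4)^k ∧ M ^ (1-p) ≤ (1/4:ℝ)^k ∧ (1/2)^k ≤ N * r ∧
    N * r ≤ 2 * (1/2)^k := by
  have h4 : (1:ℝ) ≤ 4^k := one_le_pow₀ (by norm_num)
  obtain ⟨M, hM⟩ : ∃ M : ℝ, M = ((4:ℝ)^k) ^ (1/(p-1)) := ⟨_, rfl⟩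
  have hM1 : 1 ≤ M := by
    rw [hM]; exact Real.one_le_rpow h4 (by apply div_nonneg <;> linarith)
  have hMp : M ^ (1-p) = (1/4:ℝ)^k := by
    rw [hM, ← Real.rpow_mul (by positivity)]
    have : 1/(p-1) * (1-p) = -1 := by
      have : p - 1 ≠ 0 := by linarith
      field_simp; ring
    rw [this, Real.rpow_neg_one]; simp
  have hu : (0:ℝ) < (1/2)^k := by positivity
  have hu1 : ((1:ℝ)/2)^k ≤ 1 := pow_le_one₀ (by norm_num) (by norm_num)
  have hsq : ((1:ℝ)/4)^k = ((1/2)^k)^2 := by rw [← pow_mul, mul_comm, pow_mul]; norm_num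
  obtain ⟨r, hr⟩ : ∃ r : ℝ, r = (1/2)^k / (8 * M) := ⟨_, rfl⟩
  have hM0 : 0 < M := by linarith
  have hrpos : 0 < r := by rw [hr]; positivity
  have hrM : M * r = (1/2)^k / 8 := by rw [hr]; field_simp
  have hr8 : r ≤ (1/2)^k / 8 := by nlinarith
  refine ⟨M, r, ⌈(1/2)^k / r⌉₊, hM1, hrpos, by linarith, ?_, hMp.le, ?_, ?_⟩
  · rw [hsq]; nlinarith
  · have := Nat.le_ceil ((1/2:ℝ)^k / r)
    rwa [div_le_iff₀ hrpos] at this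
  · have := (Nat.ceil_lt_add_one (a := (1/2:ℝ)^k / r) (by positivity)).le
    calc _ ≤ ((1/2:ℝ)^k / r + 1) * r := by gcongr
      _ = (1/2)^k + r := by field_simp
      _ ≤ _ := by linarith

lemma bumps : ∃ C : ℝ, 0 ≤ C ∧ ∀ (c : E2) (r : ℝ), 0 < r → ∃ φ : E2 → ℝ,
    ContDiff ℝ (⊤ : ℕ∞) φ ∧ HasCompactSupport φ ∧ tsupport φ ⊆ closedBall c r ∧ φ c = 1 ∧
    ∀ x, ‖gradient φ x‖ ≤ C / r := by
  let b : ContDiffBump (0 : E2) := ⟨1/2, 1, by norm_num, by norm_num⟩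
  have hb : ContDiff ℝ (⊤ : ℕ∞) (b : E2 → ℝ) := b.contDiff
  obtain ⟨K, hK⟩ := (hb.of_le (m := 1) (by exact_mod_cast le_top)).lipschitzWith_of_hasCompactSupport
    b.hasCompactSupport (by norm_num)
  refine ⟨K, K.2, fun c r hr => ?_⟩
  have hts : tsupport (fun x : E2 => b (r⁻¹ • (x - c))) ⊆ closedBall c r := by
    apply closure_minimal _ isClosed_closedBall
    intro x hx
    rw [Function.mem_support] at hx
    have : r⁻¹ • (x - c) ∈ Function.support b := hx
    rw [b.support_eq, mem_ball_zero_iff, norm_smul, norm_inv, Real.norm_of_nonneg hr.le,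
      inv_mul_lt_iff₀ hr] at this
    rw [mem_closedBall, dist_eq_norm]
    change ‖x - c‖ < r * 1 at this
    linarith
  refine ⟨fun x => b (r⁻¹ • (x - c)), ?_, ?_, hts, ?_, ?_⟩
  · exact hb.comp (by fun_prop)
  · exact (isCompact_closedBall c r).of_isClosed_subset (isClosed_tsupport _) hts
  · simp only [sub_self, smul_zero]
    exact b.one_of_mem_closedBall (by simp [b])
  · intro x
    rw [gradient, LinearIsometryEquiv.norm_map]
    have hL : LipschitzWith (K * (Real.toNNReal r⁻¹)) (fun x : E2 => b (r⁻¹ • (x - c))) := by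
      apply hK.comp
      apply LipschitzWith.of_dist_le_mul
      intro x y
      rw [dist_eq_norm, dist_eq_norm, ← smul_sub, norm_smul, Real.coe_toNNReal _ (by positivity),
        Real.norm_of_nonneg (by positivity)]
      simp
    have := norm_fderiv_le_of_lipschitz ℝ hL (x₀ := x)
    rw [NNReal.coe_mul, Real.coe_toNNReal _ (by positivity)] at this
    exact this

lemma ptw (p M v : ℝ) (hp : 1 < p) (hM : 1 ≤ M) (hv : 0 ≤ v) : v ≤ M + M^(1-p) * v^p := by
  have h0 : 0 < M := by linarith
  rcases le_total v M with h | h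
  · have : 0 ≤ M^(1-p) * v^p := by positivity
    linarith
  · have hv0 : 0 < v := by linarith
    have : v^(1-p) ≤ M^(1-p) := Real.rpow_le_rpow_of_nonpos h0 h (by linarith)
    have h2 : v = v^(1-p) * v^p := by rw [← Real.rpow_add hv0]; simp
    calc v = v^(1-p) * v^p := h2
      _ ≤ M^(1-p) * v^p := by gcongr
      _ ≤ _ := by linarith

lemma int_bound (p M r D : ℝ) (hp : 1 < p) (hM : 1 ≤ M) (hr : 0 < r) (hD : 0 ≤ D) (c : E2)
    (φ : E2 → ℝ) (hts : tsupport φ ⊆ closedBall c r) (hg : ∀ x, ‖gradient φ x‖ ≤ D)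
    (V : E2 → E2) (hV : IntegrableOn (fun x => ‖V x‖ ^ p) (ball (0 : E2) 1) volume) :
    (∫ x in ball (0 : E2) 1, ⟪V x, gradient φ x⟫) ≤
      D * (M * (π * r^2) + M^(1-p) * ∫ x in ball (0 : E2) 1, ‖V x‖^p) := by
  have hvol : volume (closedBall c r) ≠ ⊤ := measure_closedBall_lt_top.ne
  haveI : IsFiniteMeasure (volume.restrict (ball (0 : E2) 1)) :=
    ⟨by rw [Measure.restrict_apply_univ]; exact measure_ball_lt_top⟩
  have hind : Integrable ((closedBall c r).indicator (fun _ => M))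
      (volume.restrict (ball (0 : E2) 1)) :=
    (integrable_const M).indicator measurableSet_closedBall
  refine (le_abs_self _).trans ?_
  rw [← Real.norm_eq_abs]
  refine (norm_integral_le_of_norm_le
    (g := fun x => D * ((closedBall c r).indicator (fun _ => M) x + M^(1-p) * ‖V x‖^p))
    ((hind.add (hV.const_mul _)).const_mul D) (Filter.Eventually.of_forall ?_)).trans ?_
  · intro x
    by_cases hx : x ∈ closedBall c r
    · rw [Set.indicator_of_mem hx]
      calc _ ≤ ‖V x‖ * ‖gradient φ x‖ := norm_inner_le_norm _ _
        _ ≤ ‖V x‖ * D := by gcongr; exact hg x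
        _ = D * ‖V x‖ := mul_comm _ _
        _ ≤ _ := by gcongr; exact ptw p M _ hp hM (norm_nonneg _)
    · have h0 : gradient φ x = 0 := by
        have : fderiv ℝ φ x = 0 := by
          by_contra h
          exact hx (hts (support_fderiv_subset ℝ h))
        rw [gradient, this, map_zero]
      rw [h0, inner_zero_right, norm_zero, Set.indicator_of_notMem hx]
      positivity
  · rw [integral_const_mul, integral_add hind (hV.const_mul _), integral_const_mul]
    gcongr
    rw [integral_indicator measurableSet_closedBall, setIntegral_const, smul_eq_mul, mul_comm]
    gcongr
    rw [measureReal_restrict_apply measurableSet_closedBall]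
    refine (measureReal_mono Set.inter_subset_left hvol).trans ?_
    rw [measureReal_def, EuclideanSpace.volume_closedBall_fin_two]
    simp [ENNReal.toReal_ofReal hr.le, ENNReal.toReal_ofReal pi_pos.le, mul_comm]

/-- For `p > 1` there are sequences of points `x_i⁻, x_i⁺` in the open unit ball `B²`
with `∑ ‖x_i⁺ − x_i⁻‖ < ∞` such that no vector field `V` on `B²` with
`∫_{B²} ‖V‖^p < ∞` satisfies
`∫_{B²} ⟨V, ∇φ⟩ = 2π ∑_i (φ(x_i⁺) − φ(x_i⁻))` for all smooth compactly supported `φ`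
with support in `B²`: the boundary of the integral `1`-current `∑_i [x_i⁻, x_i⁺]` is
not the divergence of any `L^p` vector field. -/
theorem exists_current_boundary_not_Lp_divergence (p : ℝ) (hp : 1 < p) :
    ∃ xm xp : ℕ → EuclideanSpace ℝ (Fin 2),
      (∀ i, xm i ∈ ball (0 : EuclideanSpace ℝ (Fin 2)) 1) ∧
      (∀ i, xp i ∈ ball (0 : EuclideanSpace ℝ (Fin 2)) 1) ∧
      Summable (fun i => ‖xp i - xm i‖) ∧
      ∀ V : EuclideanSpace ℝ (Fin 2) → EuclideanSpace ℝ (Fin 2),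
        IntegrableOn V (ball (0 : EuclideanSpace ℝ (Fin 2)) 1) volume →
        IntegrableOn (fun x => ‖V x‖ ^ p) (ball (0 : EuclideanSpace ℝ (Fin 2)) 1)
          volume →
        ¬ (∀ φ : EuclideanSpace ℝ (Fin 2) → ℝ, ContDiff ℝ (⊤ : ℕ∞) φ → HasCompactSupport φ →
            tsupport φ ⊆ ball (0 : EuclideanSpace ℝ (Fin 2)) 1 →
            (∫ x in ball (0 : EuclideanSpace ℝ (Fin 2)) 1, ⟪V x, gradient φ x⟫)
              = 2 * π * ∑' i, (φ (xp i) - φ (xm i))) := by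
  choose M r N hM hr hr4 hMr hMp hN1 hN2 using params p hp
  obtain ⟨C, hC, hbump⟩ := bumps
  have hu : ∀ k : ℕ, (0:ℝ) < (1/2)^k := fun k => by positivity
  have hu1 : ∀ k : ℕ, ((1:ℝ)/2)^k ≤ 1 := fun k => pow_le_one₀ (by norm_num) (by norm_num)
  have hN0 : ∀ k, 0 < N k := by
    intro k
    rcases Nat.eq_zero_or_pos (N k) with h | h
    · have h1 := hN1 k; have h2 := hu k; rw [h, Nat.cast_zero, zero_mul] at h1; linarith
    · exact h
  let S := Σ k, Fin (N k)
  have : ∀ k, Nonempty (Fin (N k)) := fun k => ⟨⟨0, hN0 k⟩⟩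
  have hinf : Infinite S := by
    refine Infinite.of_surjective (fun s : S => s.1) (fun k => ⟨⟨k, ⟨0, hN0 k⟩⟩, rfl⟩)
  obtain ⟨hden⟩ := nonempty_denumerable S
  let e : ℕ ≃ S := (Denumerable.eqv S).symm
  let c : ℕ → E2 := fun k => EuclideanSpace.single 0 ((1/2)^k / 2)
  let d : ℕ → E2 := fun k => EuclideanSpace.single 1 (2 * r k)
  have hc : ∀ k, ‖c k‖ = (1/2)^k / 2 := fun k => by
    simp only [c, EuclideanSpace.norm_single]; exact Real.norm_of_nonneg (by have := hu k; linarith)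
  have hd : ∀ k, ‖d k‖ = 2 * r k := fun k => by
    simp only [d, EuclideanSpace.norm_single]; exact Real.norm_of_nonneg (by have := hr k; linarith)
  have hcoord : ∀ x : E2, |x 0| ≤ ‖x‖ := fun x => PiLp.norm_apply_le x 0
  have hsep : ∀ j k, j ≠ k → r k < |((1:ℝ)/2)^j/2 - (1/2)^k/2| := by
    intro j k hjk
    have h1 := hr4 k
    have h2 := hu k
    rw [lt_abs]
    rcases lt_or_gt_of_ne hjk with h | h
    · left
      have : ((1:ℝ)/2)^k ≤ (1/2)^(j+1) := pow_le_pow_of_le_one (by norm_num) (by norm_num) h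
      rw [pow_succ] at this; linarith
    · right
      have : ((1:ℝ)/2)^j ≤ (1/2)^(k+1) := pow_le_pow_of_le_one (by norm_num) (by norm_num) h
      rw [pow_succ] at this; linarith
  refine ⟨fun i => c (e i).1 + d (e i).1, fun i => c (e i).1, ?_, ?_, ?_, ?_⟩
  · intro i
    rw [mem_ball_zero_iff]
    have := norm_add_le (c (e i).1) (d (e i).1)
    rw [hc, hd] at this
    have := hr4 (e i).1
    have := hu1 (e i).1
    linarith
  · intro i
    rw [mem_ball_zero_iff, hc]
    have := hu1 (e i).1
    linarith
  · have : Summable (fun s : S => ‖c s.1 - (c s.1 + d s.1)‖) := by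
      rw [summable_sigma_of_nonneg (fun _ => norm_nonneg _)]
      refine ⟨fun k => Summable.of_finite, ?_⟩
      refine Summable.of_nonneg_of_le (fun k => tsum_nonneg fun _ => norm_nonneg _) ?_
        ((summable_geometric_of_lt_one (r := (1/2:ℝ)) (by norm_num) (by norm_num)).mul_left 4)
      intro k
      have := hN2 k
      simp [hd]
      simp at this
      linarith
    exact (e.summable_iff (f := fun s : S => ‖c s.1 - (c s.1 + d s.1)‖)).2 this
  · intro V _ hV hall
    obtain ⟨A, hA⟩ : ∃ A, A = ∫ x in ball (0 : E2) 1, ‖V x‖^p := ⟨_, rfl⟩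
    have hA0 : 0 ≤ A := by rw [hA]; exact integral_nonneg fun x => by positivity
    have key : ∀ k : ℕ, 2 * π * (2:ℝ)^k ≤ C * (π + A) := by
      intro k
      obtain ⟨φ, hs, hcs, hts, hφ1, hgrad⟩ := hbump (c k) (r k) (hr k)
      have hball : closedBall (c k) (r k) ⊆ ball (0 : E2) 1 := by
        intro x hx
        rw [mem_closedBall, dist_eq_norm] at hx
        rw [mem_ball_zero_iff]
        have h3 : ‖x‖ ≤ ‖x - c k‖ + ‖c k‖ := by simpa using norm_add_le (x - c k) (c k)
        have := hr4 k
        have := hu1 k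
        rw [hc] at h3
        linarith
      have hz : ∀ x, r k < ‖x - c k‖ → φ x = 0 := by
        intro x hx
        apply image_eq_zero_of_notMem_tsupport
        intro h
        have := hts h
        rw [mem_closedBall, dist_eq_norm] at this
        linarith
      have hsum : ∑' i, (φ (c (e i).1) - φ (c (e i).1 + d (e i).1)) = N k := by
        rw [e.tsum_eq (fun s : S => φ (c s.1) - φ (c s.1 + d s.1))]
        have hdk : ∀ j, φ (c j + d j) = 0 := by
          intro j
          apply hz
          by_cases hj : j = k
          · subst hj
            have := hr j
            simp [hd]; linarith
          · refine lt_of_lt_of_le ?_ (hcoord _)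
            have := hsep j k hj
            simpa [c, d] using this
        have hck : ∀ j, φ (c j) = if j = k then 1 else 0 := by
          intro j
          split_ifs with hj
          · rw [hj, hφ1]
          · apply hz
            refine lt_of_lt_of_le ?_ (hcoord _)
            have := hsep j k hj
            simpa [c, d] using this
        simp only [hdk, hck, sub_zero]
        rw [tsum_eq_sum (s := (Finset.univ : Finset (Fin (N k))).map (Function.Embedding.sigmaMk k))]
        · rw [Finset.sum_map]
          simp
        · rintro ⟨j, i⟩ hji
          rw [if_neg]
          rintro rfl
          simp at hji
      have h1 := hall φ hs hcs (hts.trans hball)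
      rw [hsum] at h1
      have h2 := int_bound p (M k) (r k) (C / r k) hp (hM k) (hr k)
        (div_nonneg hC (hr k).le) (c k) φ hts hgrad V hV
      rw [h1, ← hA, div_mul_eq_mul_div, le_div_iff₀ (hr k)] at h2
      have h3 : M k * (π * r k ^2) + (M k)^(1-p) * A ≤ (1/4)^k * (π + A) := by
        have := mul_le_mul_of_nonneg_left (hMr k) pi_pos.le
        have := mul_le_mul_of_nonneg_right (hMp k) hA0
        linarith
      have h4 : 2 * π * (1/2)^k ≤ C * ((1/4)^k * (π + A)) := by
        have := mul_le_mul_of_nonneg_left (hN1 k) (by positivity : 0 ≤ 2 * π)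
        have := mul_le_mul_of_nonneg_left h3 hC
        linarith
      have h5 := mul_le_mul_of_nonneg_right h4 (by positivity : (0:ℝ) ≤ 4^k)
      have e1 : ((1:ℝ)/2)^k * 4^k = 2^k := by rw [← mul_pow]; norm_num
      have e2 : ((1:ℝ)/4)^k * 4^k = 1 := by rw [← mul_pow]; norm_num
      calc 2 * π * (2:ℝ)^k = 2 * π * (1/2)^k * 4^k := by rw [← e1]; ring
        _ ≤ _ := h5
        _ = C * (π + A) * ((1/4)^k * 4^k) := by ring
        _ = _ := by rw [e2, mul_one]
    obtain ⟨k, hk⟩ := pow_unbounded_of_one_lt (C * (π + A)) (one_lt_two)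
    have h1 := key k
    have h2 : (0:ℝ) < 2^k := by positivity
    nlinarith [pi_gt_three]
end
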